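/- Assume CH and that there exists S ⊆ S²₀ such that both S and S²₀∖S are stationary in ω₂, but there is no α ∈ S²₁ such that both α∩S and α∩(S²₀∖S) are stationary in α. Then there exist linear orders 𝔄 and 𝔅 of cardinality ℵ₂ such that the game EF_{ω₁}(𝔄,𝔅) is non-determined (neither ∀ nor ∃ has a winning strategy). -/

import Mathlib

noncomputable section

def omega1 : Ordinal.{0} := (Cardinal.aleph 1).ord
def omega2 : Ordinal.{0} := (Cardinal.aleph 2).ord

/-- A relation `π ⊆ A × B` is a partial isomorphism of linear orders. -/
def IsPartialIsoLO {A B : Type*} [LinearOrder A] [LinearOrder B] (π : Set (A × B)) : Prop :=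
  ∀ p ∈ π, ∀ q ∈ π, ((p : A × B).1 < (q : A × B).1 ↔ p.2 < q.2) ∧ (p.1 = q.1 ↔ p.2 = q.2)

/-- `p` is a legal reply to the move `m ∈ A ∪ B`: the pair `p` records `m` in the
corresponding coordinate (the other coordinate being the opponent's answer). -/
def MatchesLO {A B : Type*} (m : A ⊕ B) (p : A × B) : Prop :=
  Sum.elim (fun a => p.1 = a) (fun b => p.2 = b) m

/-- Player ∃ has a winning strategy in the Ehrenfeucht–Fraïssé game `EF_γ(A,B)`.
A strategy for ∃ maps each sequence of moves of ∀ (elements of `A ⊕ B`, indexed by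
the rounds `i < γ`) to ∃'s answers, recorded as the pair played at each round; it
must only depend on the moves of rounds `≤ β` (causality), answer in the other
structure (legality), and always produce a partial isomorphism (winning). -/
def EFExistsWin (γ : Ordinal.{0}) (A B : Type*) [LinearOrder A] [LinearOrder B] : Prop :=
  ∃ σ : (↥(Set.Iio γ) → A ⊕ B) → ↥(Set.Iio γ) → A × B,
    (∀ x x' β, (∀ i : ↥(Set.Iio γ), i.1 ≤ β.1 → x i = x' i) → σ x β = σ x' β) ∧
    (∀ x β, MatchesLO (x β) (σ x β)) ∧
    (∀ x, IsPartialIsoLO (Set.range (σ x)))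

/-- Player ∀ has a winning strategy in the Ehrenfeucht–Fraïssé game `EF_γ(A,B)`.
A strategy for ∀ maps each sequence of recorded rounds (the pairs resulting from
∃'s answers) to ∀'s moves; it must only depend on the rounds `< β` (causality),
and it is winning if every play following it (i.e. every sequence of pairs each of
which is a legal reply to the corresponding move of the strategy) results in a
relation that is not a partial isomorphism. -/
def EFForallWin (γ : Ordinal.{0}) (A B : Type*) [LinearOrder A] [LinearOrder B] : Prop :=
  ∃ τ : (↥(Set.Iio γ) → A × B) → ↥(Set.Iio γ) → A ⊕ B,
    (∀ y y' β, (∀ i : ↥(Set.Iio γ), i.1 < β.1 → y i = y' i) → τ y β = τ y' β) ∧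
    (∀ y, (∀ β, MatchesLO (τ y β) (y β)) → ¬ IsPartialIsoLO (Set.range y))

def S20 : Set Ordinal.{0} := {α | α < omega2 ∧ α.cof = Cardinal.aleph0}
def S21 : Set Ordinal.{0} := {α | α < omega2 ∧ α.cof = Cardinal.aleph 1}

def ClosedIn (C : Set Ordinal.{0}) (δ : Ordinal.{0}) : Prop :=
  ∀ α < δ, α ≠ 0 → (∀ β < α, ∃ γ ∈ C, β < γ ∧ γ < α) → α ∈ C

def UnbddIn (C : Set Ordinal.{0}) (δ : Ordinal.{0}) : Prop :=
  ∀ β < δ, ∃ γ ∈ C, β < γ ∧ γ < δ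

def StationaryIn (X : Set Ordinal.{0}) (δ : Ordinal.{0}) : Prop :=
  ∀ C : Set Ordinal.{0}, C ⊆ Set.Iio δ → ClosedIn C δ → UnbddIn C δ → (X ∩ C).Nonempty

open Cardinal Ordinal Set

/-! ### Gluing order isomorphisms along monotone maps -/

theorem orderIso_of_fibers {X Y I : Type*} [LinearOrder X] [LinearOrder Y] [LinearOrder I]
    (a : X → I) (ha : Monotone a) (b : Y → I) (hb : Monotone b)
    (h : ∀ i, Nonempty ({x // a x = i} ≃o {y // b y = i})) : Nonempty (X ≃o Y) := by
  let F := fun i => (h i).some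
  have key : ∀ i x (hx : a x = i), (F (a x) ⟨x, rfl⟩).1 = (F i ⟨x, hx⟩).1 := by
    rintro i x rfl; rfl
  refine ⟨StrictMono.orderIsoOfSurjective (fun x => (F (a x) ⟨x, rfl⟩).1) ?_ ?_⟩
  · intro x x' hxx
    rcases (ha hxx.le).lt_or_eq with hlt | heq
    · refine lt_of_not_ge fun hle => ?_
      have := hb hle
      rw [(F (a x) ⟨x, rfl⟩).2, (F (a x') ⟨x', rfl⟩).2] at this
      exact this.not_gt hlt
    · change (F (a x) ⟨x, rfl⟩).1 < (F (a x') ⟨x', rfl⟩).1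
      rw [key _ x heq]
      exact (F (a x')).strictMono (a := ⟨x, heq⟩) (b := ⟨x', rfl⟩) hxx
  · intro y
    refine ⟨((F (b y)).symm ⟨y, rfl⟩).1, ?_⟩
    change (F _ ⟨_, rfl⟩).1 = y
    rw [key (b y) _ ((F (b y)).symm ⟨y, rfl⟩).2]
    simp

/-- An order isomorphism from a strictly monotone surjection. -/
theorem nonempty_orderIso_of_strictMono {X Y : Type*} [LinearOrder X] [Preorder Y] (f : X → Y)
    (hf : StrictMono f) (hs : Function.Surjective f) : Nonempty (X ≃o Y) :=
  ⟨hf.orderIsoOfSurjective f hs⟩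

/-! ### Cantor's theorem for coloured countable dense orders -/

/-- Every colour occurs in every open interval, including the unbounded ones. -/
structure DenseColoring {D κ : Type*} [LinearOrder D] (c : D → κ) : Prop where
  below : ∀ k x, ∃ y < x, c y = k
  above : ∀ k x, ∃ y, x < y ∧ c y = k
  between : ∀ k x y, x < y → ∃ z, x < z ∧ z < y ∧ c z = k

theorem DenseColoring.exists_between_finsets {D κ : Type*} [LinearOrder D] [Nonempty D] {c : D → κ}
    (hc : DenseColoring c) (k : κ) (lo hi : Finset D) (h : ∀ x ∈ lo, ∀ y ∈ hi, x < y) :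
    ∃ m, c m = k ∧ (∀ x ∈ lo, x < m) ∧ ∀ y ∈ hi, m < y := by
  have : DenselyOrdered D :=
    ⟨fun x y hxy => let ⟨z, h1, h2, _⟩ := hc.between k x y hxy; ⟨z, h1, h2⟩⟩
  have : NoMinOrder D := ⟨fun x => let ⟨z, h1, _⟩ := hc.below k x; ⟨z, h1⟩⟩
  have : NoMaxOrder D := ⟨fun x => let ⟨z, h1, _⟩ := hc.above k x; ⟨z, h1⟩⟩
  obtain ⟨m, hm1, hm2⟩ := Order.exists_between_finsets lo hi h
  obtain ⟨n, hn1, hn2⟩ := Order.exists_between_finsets (insert m lo) hi (by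
    intro x hx y hy
    rcases Finset.mem_insert.1 hx with rfl | hx
    exacts [hm2 y hy, h x hx y hy])
  obtain ⟨z, hz1, hz2, hz⟩ := hc.between k m n (hn1 m (Finset.mem_insert_self _ _))
  exact ⟨z, hz, fun x hx => (hm1 x hx).trans hz1, fun y hy => hz2.trans (hn2 y hy)⟩

/-- A finite colour-preserving partial isomorphism extends to one more point of the domain. -/
theorem DenseColoring.exists_across {α β κ : Type*} [LinearOrder α] [LinearOrder β] [Nonempty β]
    {c : α → κ} {c' : β → κ} (hc : DenseColoring c') (f : Finset (α × β))
    (hf : ∀ p ∈ f, ∀ q ∈ f, cmp p.1 q.1 = cmp p.2 q.2) (hf' : ∀ p ∈ f, c p.1 = c' p.2) (a : α) :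
    ∃ b, c a = c' b ∧ ∀ p ∈ f, cmp p.1 a = cmp p.2 b := by
  by_cases h : ∃ b, (a, b) ∈ f
  · obtain ⟨b, hb⟩ := h
    exact ⟨b, hf' _ hb, fun p hp => hf _ hp _ hb⟩
  obtain ⟨b, hcb, hb⟩ := hc.exists_between_finsets (c a)
    ({p ∈ f | p.1 < a}.image Prod.snd) ({p ∈ f | a < p.1}.image Prod.snd) (by
      intro x hx y hy
      rw [Finset.mem_image] at hx hy
      rcases hx with ⟨p, hp1, rfl⟩
      rcases hy with ⟨q, hq1, rfl⟩
      rw [Finset.mem_filter] at hp1 hq1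
      rw [← lt_iff_lt_of_cmp_eq_cmp (hf _ hp1.1 _ hq1.1)]
      exact lt_trans hp1.right hq1.right)
  refine ⟨b, hcb.symm, ?_⟩
  rintro ⟨p1, p2⟩ hp
  have hne : p1 ≠ a := fun he => h ⟨p2, he ▸ hp⟩
  rcases lt_or_gt_of_ne hne with hl | hr
  · have : p1 < a ∧ p2 < b :=
      ⟨hl, hb.1 _ (Finset.mem_image.mpr ⟨(p1, p2), Finset.mem_filter.mpr ⟨hp, hl⟩, rfl⟩)⟩
    rw [← cmp_eq_lt_iff, ← cmp_eq_lt_iff] at this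
    exact this.1.trans this.2.symm
  · have : a < p1 ∧ b < p2 :=
      ⟨hr, hb.2 _ (Finset.mem_image.mpr ⟨(p1, p2), Finset.mem_filter.mpr ⟨hp, hr⟩, rfl⟩)⟩
    rw [← cmp_eq_gt_iff, ← cmp_eq_gt_iff] at this
    exact this.1.trans this.2.symm

/-- Finite colour-preserving partial isomorphisms. -/
def ColoredPartialIso {α β κ : Type*} [LinearOrder α] [LinearOrder β] (c : α → κ) (c' : β → κ) :
    Type _ :=
  {f : Finset (α × β) //
    (∀ p ∈ f, ∀ q ∈ f, cmp p.1 q.1 = cmp p.2 q.2) ∧ ∀ p ∈ f, c p.1 = c' p.2}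

instance {α β κ : Type*} [LinearOrder α] [LinearOrder β] (c : α → κ) (c' : β → κ) :
    Preorder (ColoredPartialIso c c') :=
  inferInstanceAs (Preorder {_f : Finset (α × β) // _})

theorem ColoredPartialIso.exists_insert {α β κ : Type*} [LinearOrder α] [LinearOrder β]
    {c : α → κ} {c' : β → κ} (f : ColoredPartialIso c c') (a : α) (b : β) (hab : c a = c' b)
    (h : ∀ p ∈ f.1, cmp p.1 a = cmp p.2 b) : ∃ g : ColoredPartialIso c c', (a, b) ∈ g.1 ∧ f ≤ g := by
  refine ⟨⟨insert (a, b) f.1, fun p hp q hq => ?_, fun p hp => ?_⟩, Finset.mem_insert_self _ _,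
    Finset.subset_insert _ _⟩
  · rw [Finset.mem_insert] at hp hq
    rcases hp with (rfl | pf) <;> rcases hq with (rfl | qf)
    · simp only [cmp_self_eq_eq]
    · rw [cmp_eq_cmp_symm]
      exact h _ qf
    · exact h _ pf
    · exact f.2.1 _ pf _ qf
  · rcases Finset.mem_insert.1 hp with rfl | hp
    exacts [hab, f.2.2 p hp]

theorem exists_colored_orderIso {α β κ : Type*} [LinearOrder α] [LinearOrder β] [Countable α]
    [Countable β] [Nonempty α] [Nonempty β] {c : α → κ} {c' : β → κ}
    (hc : DenseColoring c) (hc' : DenseColoring c') : ∃ e : α ≃o β, ∀ a, c' (e a) = c a := by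
  obtain ⟨_⟩ := nonempty_encodable α
  obtain ⟨_⟩ := nonempty_encodable β
  let C : α ⊕ β → Order.Cofinal (ColoredPartialIso c c') := fun p =>
    { carrier := {f | Sum.elim (fun a => ∃ b, (a, b) ∈ f.1) (fun b => ∃ a, (a, b) ∈ f.1) p}
      isCofinal := by
        intro f
        rcases p with a | b
        · obtain ⟨b, hb, h⟩ := hc'.exists_across f.1 f.2.1 f.2.2 a
          obtain ⟨g, hg, hfg⟩ := f.exists_insert a b hb h
          exact ⟨g, ⟨b, hg⟩, hfg⟩
        · obtain ⟨a, hb, h⟩ := hc.exists_across (c := c') (f.1.image Prod.swap)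
            (by simp only [Finset.forall_mem_image]; exact fun x hx y hy => (f.2.1 x hx y hy).symm)
            (by simp only [Finset.forall_mem_image]; exact fun x hx => (f.2.2 x hx).symm) b
          obtain ⟨g, hg, hfg⟩ := f.exists_insert a b hb.symm
            (fun p hp => (h p.swap (Finset.mem_image_of_mem _ hp)).symm)
          exact ⟨g, ⟨a, hg⟩, hfg⟩ }
  let I := Order.idealOfCofinals (⟨∅, by simp, by simp⟩ : ColoredPartialIso c c') C
  have hF : ∀ a, ∃ b, ∃ f ∈ I, (a, b) ∈ f.1 := fun a => by
    obtain ⟨f, ⟨b, hb⟩, hf⟩ := Order.cofinal_meets_idealOfCofinals _ C (Sum.inl a)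
    exact ⟨b, f, hf, hb⟩
  have hG : ∀ b, ∃ a, ∃ f ∈ I, (a, b) ∈ f.1 := fun b => by
    obtain ⟨f, ⟨a, ha⟩, hf⟩ := Order.cofinal_meets_idealOfCofinals _ C (Sum.inr b)
    exact ⟨a, f, hf, ha⟩
  choose F hF using hF
  choose G hG using hG
  refine ⟨OrderIso.ofCmpEqCmp F G fun a b => ?_, fun a => ?_⟩
  · obtain ⟨f, hf, ha⟩ := hF a
    obtain ⟨g, hg, hb⟩ := hG b
    obtain ⟨m, _, fm, gm⟩ := I.directed _ hf _ hg
    exact m.2.1 (a, _) (fm ha) (_, b) (gm hb)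
  · obtain ⟨f, hf, ha⟩ := hF a
    exact (f.2.2 _ ha).symm

/-- A countable dense order coloured with three dense colours: the numbers `a + b√2` with
`a` rational and `b ∈ {0, 1, 2}`, coloured by `b`. -/
def ColoredRat : Type := ℚ × Fin 3

namespace ColoredRat

/-- The real number represented by an element of `ColoredRat`. -/
def toReal (q : ColoredRat) : ℝ := q.1 + (q.2 : ℕ) * √2

/-- The colour of an element of `ColoredRat`. -/
def color (q : ColoredRat) : Fin 3 := q.2

theorem toReal_injective : Function.Injective toReal := by
  rintro ⟨a, b⟩ ⟨a', b'⟩ h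
  simp only [toReal] at h
  have hb : b = b' := by
    by_contra hne
    have hne' : (((b : ℕ) : ℚ) - ((b' : ℕ) : ℚ)) ≠ 0 := by
      rw [sub_ne_zero]
      exact_mod_cast fun h => hne (Fin.ext h)
    refine irrational_sqrt_two.ne_rat ((a' - a) / (((b : ℕ) : ℚ) - ((b' : ℕ) : ℚ))) ?_
    have hne'' : (((b : ℕ) : ℝ) - ((b' : ℕ) : ℝ)) ≠ 0 := by exact_mod_cast hne'
    push_cast
    rw [eq_div_iff hne'']
    linarith
  subst hb
  have : (a : ℝ) = a' := by linarith
  rw [Rat.cast_injective this]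

instance : LinearOrder ColoredRat := LinearOrder.lift' toReal toReal_injective
instance : Countable ColoredRat := inferInstanceAs (Countable (ℚ × Fin 3))
instance : Inhabited ColoredRat := inferInstanceAs (Inhabited (ℚ × Fin 3))

theorem exists_toReal_mem (k : Fin 3) {x y : ℝ} (h : x < y) :
    ∃ z : ColoredRat, x < z.toReal ∧ z.toReal < y ∧ z.color = k := by
  obtain ⟨r, h1, h2⟩ := exists_rat_btwn (sub_lt_sub_right h ((k : ℕ) * √2))
  exact ⟨(r, k), by simp only [toReal]; linarith, by simp only [toReal]; linarith, rfl⟩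

theorem denseColoring : DenseColoring color where
  below k x :=
    let ⟨z, _, h2, h3⟩ := exists_toReal_mem k (sub_one_lt x.toReal); ⟨z, h2, h3⟩
  above k x :=
    let ⟨z, h1, _, h3⟩ := exists_toReal_mem k (lt_add_one x.toReal); ⟨z, h1, h3⟩
  between k _ _ hxy := exists_toReal_mem k hxy

end ColoredRat

/-! ### An order isomorphic to a shuffle of `1`, of its own `ω₁`-sum, and of its own `ω₁`-sum with
a point added at every limit stage -/

/-- The admissible second coordinates of letters of colour `k`; the Boolean says whether the
word continues after the letter. -/
def IsMarked (k : Fin 3) (i : Ordinal.{0}) (t : Bool) : Prop :=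
  if k = 0 then i = 0 ∧ t = false
  else if k = 1 then i < omega1 ∧ t = true
  else i < omega1 ∧ (t = false → Order.IsSuccLimit i)

/-- The alphabet underlying the order `Theta`. -/
abbrev Letter : Type 1 := ColoredRat ×ₗ (Ordinal.{0} ×ₗ Bool)

/-- The words forming the order `Theta`. -/
def IsWord : List Letter → Prop
  | [] => False
  | k :: w => IsMarked (ofLex k).1.color (ofLex (ofLex k).2).1 (ofLex (ofLex k).2).2 ∧
      ((ofLex (ofLex k).2).2 = true → IsWord w) ∧ ((ofLex (ofLex k).2).2 = false → w = [])

/-- The lexicographically ordered set of words. -/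
def Theta : Type 1 := {w : List Letter // IsWord w}

namespace Theta

instance : LinearOrder Theta := inferInstanceAs (LinearOrder {w : List Letter // IsWord w})

/-- The summands of which `Theta` is a shuffle. -/
def block (k : Fin 3) : Set (Ordinal.{0} ×ₗ WithBot Theta) :=
  {p | ((ofLex p).2 = ⊥ → IsMarked k (ofLex p).1 false) ∧
    ((ofLex p).2 ≠ ⊥ → IsMarked k (ofLex p).1 true)}

/-- The first coordinate of the first letter. -/
def head : Theta → ColoredRat
  | ⟨[], h⟩ => h.elim
  | ⟨k :: _, _⟩ => (ofLex k).1

/-- The word with first letter given by `q` and `i`, continued by `z` unless `z = ⊥`. -/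
def consWord (q : ColoredRat) (i : Ordinal.{0}) (z : WithBot Theta) : List Letter :=
  WithBot.recBotCoe [toLex (q, toLex (i, false))] (fun w => toLex (q, toLex (i, true)) :: w.1) z

theorem isWord_consWord {q : ColoredRat} {p : Ordinal.{0} ×ₗ WithBot Theta} (hp : p ∈ block q.color) :
    IsWord (consWord q (ofLex p).1 (ofLex p).2) := by
  obtain ⟨h1, h2⟩ := hp
  generalize (ofLex p).2 = z at h1 h2
  induction z using WithBot.recBotCoe with
  | bot => exact ⟨h1 rfl, by simp, by simp⟩
  | coe w => exact ⟨h2 (by simp), fun _ => w.2, by simp⟩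

theorem consWord_lt_consWord (q : ColoredRat) {p p' : Ordinal.{0} ×ₗ WithBot Theta} (h : p < p') :
    consWord q (ofLex p).1 (ofLex p).2 < consWord q (ofLex p').1 (ofLex p').2 := by
  have rel : ∀ {k k' : Letter} {w w' : List Letter}, k < k' → k :: w < k' :: w' :=
    fun h => List.Lex.rel h
  rw [Prod.Lex.lt_iff] at h
  generalize (ofLex p).2 = z at h
  generalize (ofLex p').2 = z' at h
  generalize (ofLex p).1 = i at h
  generalize (ofLex p').1 = i' at h
  induction z using WithBot.recBotCoe with
  | bot =>
    induction z' using WithBot.recBotCoe with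
    | bot => exact rel (by simpa [Prod.Lex.toLex_lt_toLex] using h)
    | coe w' =>
      refine rel ?_
      simpa [Prod.Lex.toLex_lt_toLex, le_iff_lt_or_eq] using h
  | coe w =>
    induction z' using WithBot.recBotCoe with
    | bot =>
      have h' : i < i' := by simpa using h
      exact rel (by simp [Prod.Lex.toLex_lt_toLex, h'])
    | coe w' =>
      rcases h with h | ⟨rfl, h⟩
      · exact rel (by simp [Prod.Lex.toLex_lt_toLex, h])
      · exact List.Lex.cons (WithBot.coe_lt_coe.1 h)

theorem monotone_head : Monotone head := by
  rintro ⟨w, hw⟩ ⟨w', hw'⟩ h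
  match w, w', hw, hw' with
  | k :: w, k' :: w', hw, hw' =>
    have hk : k ≤ k' := by
      rcases h.lt_or_eq with h | h
      · exact List.head_le_of_lt (show (k :: w : List Letter) < k' :: w' from h)
      · exact (List.cons.inj (Subtype.ext_iff.1 h)).1.le
    exact Prod.Lex.monotone_fst _ _ hk

theorem head_consWord (q : ColoredRat) (i : Ordinal.{0}) (z : WithBot Theta)
    (h : IsWord (consWord q i z)) : head ⟨consWord q i z, h⟩ = q := by
  induction z using WithBot.recBotCoe with
  | bot => rfl
  | coe w => rfl

theorem fiber_head (q : ColoredRat) : Nonempty ({w // head w = q} ≃o block q.color) := by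
  obtain ⟨e⟩ := nonempty_orderIso_of_strictMono
    (fun p : block q.color => (⟨⟨_, isWord_consWord p.2⟩, head_consWord _ _ _ _⟩ :
      {w // head w = q})) (fun p p' h => consWord_lt_consWord q h) (by
    rintro ⟨⟨w, hw⟩, hq⟩
    match w, hw with
    | k :: w, hw =>
      obtain ⟨q', k⟩ := k
      obtain ⟨i, t⟩ := k
      obtain rfl : q' = q := hq
      cases t with
      | false =>
        obtain rfl : w = [] := hw.2.2 rfl
        exact ⟨⟨toLex (i, ⊥), ⟨fun _ => hw.1, fun h => (h rfl).elim⟩⟩, rfl⟩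
      | true =>
        let w' : Theta := ⟨w, hw.2.1 rfl⟩
        exact ⟨⟨toLex (i, (w' : WithBot Theta)),
          ⟨fun h => (WithBot.coe_ne_bot h).elim, fun _ => hw.1⟩⟩, rfl⟩)
  exact ⟨e.symm⟩

theorem exists_head_eq (q : ColoredRat) (hq : q.color = 0) : ∃ w, head w = q := by
  obtain ⟨e⟩ := fiber_head q
  have : (toLex ((0 : Ordinal.{0}), (⊥ : WithBot Theta))) ∈ block q.color := by
    simp [block, IsMarked, hq]
  exact ⟨_, (e.symm ⟨_, this⟩).2⟩

instance : Nonempty Theta := by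
  obtain ⟨q, _, hq⟩ := ColoredRat.denseColoring.below 0 default
  exact ⟨(exists_head_eq q hq).choose⟩

instance : NoMinOrder Theta where
  exists_lt w := by
    obtain ⟨q, hlt, hq⟩ := ColoredRat.denseColoring.below 0 (head w)
    obtain ⟨w', rfl⟩ := exists_head_eq q hq
    exact ⟨w', monotone_head.reflect_lt hlt⟩

/-- Uniqueness of shuffles: an order that is a countable sum, with sufficiently many summands
isomorphic to `Theta` and the other summands among the blocks of `Theta`, is isomorphic
to `Theta`. -/
theorem orderIso_of_countable_sum {M E : Type*} [LinearOrder M] [LinearOrder E] [Countable E]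
    [Nonempty E] (a : M → E) (ha : Monotone a) (s : Set E)
    (hs : ∀ e ∈ s, Nonempty ({m // a m = e} ≃o Theta))
    (hns : ∀ e ∉ s, IsEmpty {m // a m = e} ∨ ∃ k, Nonempty ({m // a m = e} ≃o block k))
    (h1 : ∀ e, ∃ e' ∈ s, e' ≤ e) (h2 : ∀ e, ∃ e' ∈ s, e ≤ e')
    (h3 : ∀ e e', e < e' → e ∉ s → e' ∉ s → ∃ e'' ∈ s, e < e'' ∧ e'' < e') :
    Nonempty (M ≃o Theta) := by
  classical
  let F := fun e he => (hs e he).some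
  have hns' : ∀ e, ∃ k, e ∉ s → Nonempty {m // a m = e} → Nonempty ({m // a m = e} ≃o block k) := by
    intro e
    by_cases he : e ∈ s
    · exact ⟨0, fun h => (h he).elim⟩
    · rcases hns e he with h | ⟨k, hk⟩
      · exact ⟨0, fun _ h' => (not_isEmpty_of_nonempty _ h).elim⟩
      · exact ⟨k, fun _ _ => hk⟩
  choose c hc using hns'
  let q₀ : ColoredRat := default
  let D := {p : E ×ₗ ColoredRat //
    (ofLex p).1 ∈ s ∨ ((ofLex p).2 = q₀ ∧ Nonempty {m // a m = (ofLex p).1})}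
  have : Countable D := by
    have : Countable (E ×ₗ ColoredRat) := inferInstanceAs (Countable (E × ColoredRat))
    exact Subtype.countable
  let col : D → Fin 3 := fun p => if (ofLex p.1).1 ∈ s then (ofLex p.1).2.color else c (ofLex p.1).1
  have hD : Nonempty D := by
    obtain ⟨e, he, _⟩ := h1 (Classical.arbitrary E)
    exact ⟨⟨toLex (e, q₀), Or.inl he⟩⟩
  have new : ∀ e ∈ s, ∀ q, ∃ z : D, z.1 = toLex (e, q) ∧ col z = q.color := fun e he q =>
    ⟨⟨toLex (e, q), Or.inl he⟩, rfl, if_pos he⟩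
  have lt_def : ∀ x y : D, x < y ↔ ((ofLex x.1).1 < (ofLex y.1).1 ∨
      (ofLex x.1).1 = (ofLex y.1).1 ∧ (ofLex x.1).2 < (ofLex y.1).2) := fun x y =>
    Prod.Lex.lt_iff
  have hbelow : ∀ k (x : D), (ofLex x.1).1 ∈ s →
      ∃ y < x, col y = k ∧ (ofLex y.1).1 = (ofLex x.1).1 := by
    intro k x hx
    obtain ⟨q, hq, hqk⟩ := ColoredRat.denseColoring.below k (ofLex x.1).2
    obtain ⟨z, hz, hzc⟩ := new _ hx q
    exact ⟨z, by simp [lt_def, hz, hq], hzc.trans hqk, by simp [hz]⟩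
  have habove : ∀ k (x : D), (ofLex x.1).1 ∈ s →
      ∃ y, x < y ∧ col y = k ∧ (ofLex y.1).1 = (ofLex x.1).1 := by
    intro k x hx
    obtain ⟨q, hq, hqk⟩ := ColoredRat.denseColoring.above k (ofLex x.1).2
    obtain ⟨z, hz, hzc⟩ := new _ hx q
    exact ⟨z, by simp [lt_def, hz, hq], hzc.trans hqk, by simp [hz]⟩
  have hone : ∀ k, ∃ q : ColoredRat, q.color = k := fun k =>
    let ⟨q, _, hq⟩ := ColoredRat.denseColoring.below k q₀; ⟨q, hq⟩
  have hcol : DenseColoring col := by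
    refine ⟨fun k x => ?_, fun k x => ?_, fun k x y hxy => ?_⟩
    · by_cases hx : (ofLex x.1).1 ∈ s
      · obtain ⟨y, h, h', _⟩ := hbelow k x hx
        exact ⟨y, h, h'⟩
      · obtain ⟨e, he, hle⟩ := h1 (ofLex x.1).1
        obtain ⟨q, hq⟩ := hone k
        obtain ⟨z, hz, hzc⟩ := new e he q
        refine ⟨z, ?_, hzc.trans hq⟩
        rw [lt_def, hz]
        exact Or.inl (hle.lt_of_ne fun h => hx (h ▸ he))
    · by_cases hx : (ofLex x.1).1 ∈ s
      · obtain ⟨y, h, h', _⟩ := habove k x hx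
        exact ⟨y, h, h'⟩
      · obtain ⟨e, he, hle⟩ := h2 (ofLex x.1).1
        obtain ⟨q, hq⟩ := hone k
        obtain ⟨z, hz, hzc⟩ := new e he q
        refine ⟨z, ?_, hzc.trans hq⟩
        rw [lt_def, hz]
        exact Or.inl (hle.lt_of_ne fun h => hx (h ▸ he))
    · rcases (lt_def x y).1 hxy with h | ⟨h, hq⟩
      · by_cases hx : (ofLex x.1).1 ∈ s
        · obtain ⟨z, hz, hzk, hze⟩ := habove k x hx
          exact ⟨z, hz, by rw [lt_def, hze]; exact Or.inl h, hzk⟩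
        by_cases hy : (ofLex y.1).1 ∈ s
        · obtain ⟨z, hz, hzk, hze⟩ := hbelow k y hy
          exact ⟨z, by rw [lt_def, hze]; exact Or.inl h, hz, hzk⟩
        obtain ⟨e, he, hxe, hey⟩ := h3 _ _ h hx hy
        obtain ⟨q, hq⟩ := hone k
        obtain ⟨z, hz, hzc⟩ := new e he q
        refine ⟨z, ?_, ?_, hzc.trans hq⟩
        · rw [lt_def, hz]; exact Or.inl hxe
        · rw [lt_def, hz]; exact Or.inl hey
      · have hx : (ofLex x.1).1 ∈ s := by
          rcases x.2 with hx | hx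
          · exact hx
          rcases y.2 with hy | hy
          · exact h ▸ hy
          · rw [hx.1, hy.1] at hq
            exact (lt_irrefl _ hq).elim
        obtain ⟨q, h1, h2, hqk⟩ := ColoredRat.denseColoring.between k _ _ hq
        obtain ⟨z, hz, hzc⟩ := new _ hx q
        refine ⟨z, ?_, ?_, hzc.trans hqk⟩
        · rw [lt_def, hz]; exact Or.inr ⟨rfl, h1⟩
        · rw [lt_def, hz]; exact Or.inr ⟨h, h2⟩
  obtain ⟨e, he⟩ := exists_colored_orderIso hcol ColoredRat.denseColoring
  let hd : M → ColoredRat := fun m => if h : a m ∈ s then head (F (a m) h ⟨m, rfl⟩) else q₀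
  have hd_eq : ∀ x (hx : x ∈ s) (m : {m // a m = x}), hd m.1 = head (F x hx m) := by
    rintro _ hx ⟨m, rfl⟩
    exact dif_pos hx
  let b : M → D := fun m => ⟨toLex (a m, hd m), by
    by_cases h : a m ∈ s
    · exact Or.inl h
    · exact Or.inr ⟨dif_neg h, ⟨⟨m, rfl⟩⟩⟩⟩
  have hb : Monotone b := by
    intro m m' hm
    refine not_lt.1 fun hlt => ?_
    rcases (lt_def _ _).1 hlt with h | ⟨h, hq⟩
    · exact h.not_ge (ha hm)
    · replace h : a m' = a m := h
      replace hq : hd m' < hd m := hq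
      by_cases hms : a m ∈ s
      · rw [hd_eq _ hms ⟨m', h⟩, hd_eq _ hms ⟨m, rfl⟩] at hq
        refine hq.not_ge (monotone_head ((F (a m) hms).monotone ?_))
        exact hm
      · have hms' : a m' ∉ s := h ▸ hms
        simp only [hd, dif_neg hms, dif_neg hms', lt_irrefl] at hq
  refine orderIso_of_fibers (e ∘ b) (e.monotone.comp hb) head monotone_head fun q => ?_
  obtain ⟨x, rfl⟩ := e.surjective q
  obtain ⟨G⟩ := fiber_head (e x)
  suffices h : Nonempty ({m // b m = x} ≃o block (e x).color) by
    obtain ⟨H⟩ := h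
    have : ∀ m, (e ∘ b) m = e x ↔ b m = x := fun m => e.injective.eq_iff
    exact ⟨(OrderIso.setCongr {m | (e ∘ b) m = e x} {m | b m = x} (Set.ext this)).trans
      (H.trans G.symm)⟩
  rw [he x]
  have b_eq : ∀ m, b m = x ↔ a m = (ofLex x.1).1 ∧ hd m = (ofLex x.1).2 := fun m => by
    rw [Subtype.ext_iff]
    exact ⟨fun h => ⟨congrArg (fun z => (ofLex z).1) h, congrArg (fun z => (ofLex z).2) h⟩,
      fun h => Prod.ext h.1 h.2⟩
  by_cases hx : (ofLex x.1).1 ∈ s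
  · obtain ⟨H⟩ := fiber_head (ofLex x.1).2
    rw [show col x = (ofLex x.1).2.color from if_pos hx]
    obtain ⟨K⟩ := nonempty_orderIso_of_strictMono (fun m : {m // b m = x} =>
      (⟨F _ hx ⟨m.1, ((b_eq m.1).1 m.2).1⟩, by
        rw [← hd_eq _ hx]; exact ((b_eq m.1).1 m.2).2⟩ : {w // head w = (ofLex x.1).2}))
      (fun m m' hm => (F _ hx).strictMono hm) (by
        rintro ⟨w, hw⟩
        have hm : b ((F _ hx).symm w).1 = x := by
          rw [b_eq]
          refine ⟨((F _ hx).symm w).2, ?_⟩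
          rw [hd_eq _ hx]
          simpa using hw
        exact ⟨⟨_, hm⟩, by simp⟩)
    exact ⟨K.trans H⟩
  · rw [show col x = c (ofLex x.1).1 from if_neg hx]
    have hx' := x.2.resolve_left hx
    obtain ⟨H⟩ := hc _ hx hx'.2
    refine ⟨(OrderIso.setCongr {m | b m = x} {m | a m = (ofLex x.1).1} (Set.ext fun m => ?_)).trans H⟩
    rw [mem_ofPred_eq, mem_ofPred_eq, b_eq]
    refine ⟨And.left, fun h => ⟨h, ?_⟩⟩
    rw [hx'.1]
    exact dif_neg (h ▸ hx)

end Theta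

/-! ### Normal functions cofinal in a limit ordinal -/

/-- Suprema over initial segments shorter than the cofinality. -/
theorem iSup_Iio_lt_of_card_lt_cof {e i : Ordinal.{0}} (h : i.card < e.cof)
    {f : Iio i → Ordinal.{0}} (hf : ∀ j, f j < e) : ⨆ j, f j < e := by
  refine lift_iSup_lt_of_lt_cof ?_ hf
  rw [Cardinal.mk_Iio_ordinal, ← Ordinal.lift_cof, Cardinal.lift_lift]
  exact Cardinal.lift_lt.2 h

theorem exists_isNormal_cofinal {e d : Ordinal.{0}} (he : Order.IsSuccLimit e) (hd : d < e)
    (c : Ordinal.{0} → Ordinal.{0}) (hc : ∀ x < e, c x < e) :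
    ∃ f : Ordinal.{0} → Ordinal.{0}, Order.IsNormal f ∧ f 0 = d ∧ (∀ i < e.cof.ord, f i < e) ∧
      (∀ i, ∃ x, f (i + 1) = x + 1) ∧ (∀ i, c (f i) < f (i + 1)) ∧
      ∀ β < e, ∃ i < e.cof.ord, β < f i := by
  obtain ⟨g, hg⟩ := Ordinal.exists_isFundamentalSeq (o := e) rfl
  classical
  let h : Ordinal.{0} → Ordinal.{0} := fun i => if hi : i < e.cof.ord then (g ⟨i, hi⟩).1 else 0
  let f : Ordinal.{0} → Ordinal.{0} := fun i => Ordinal.limitRecOn (motive := fun _ => Ordinal.{0}) i d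
    (fun j x => max x (max (c x) (h j)) + 1) (fun j _ ih => ⨆ k : Iio j, ih k.1 k.2)
  have f0 : f 0 = d := limitRecOn_zero ..
  have f1 : ∀ i, f (i + 1) = max (f i) (max (c (f i)) (h i)) + 1 := fun i =>
    limitRecOn_add_one ..
  have f2 : ∀ i, Order.IsSuccLimit i → f i = ⨆ k : Iio i, f k := fun i hi =>
    limitRecOn_limit _ _ _ _ hi
  have lt1 : ∀ i x, x ≤ max (f i) (max (c (f i)) (h i)) → x < f (i + 1) := fun i x hx => by
    rw [f1]; exact Order.lt_add_one_iff.2 hx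
  have hcof : Order.IsSuccLimit e.cof.ord :=
    Cardinal.isSuccLimit_ord (aleph0_le_cof_iff.2 (one_lt_cof_iff.2 he))
  have hfn : Order.IsNormal f := by
    refine .of_succ_lt (fun i => lt1 i _ (le_max_left _ _)) fun {i} hi => ?_
    rw [f2 i hi]
    constructor
    · rintro _ ⟨j, hj, rfl⟩
      exact Ordinal.le_iSup (fun k : Iio i => f k) ⟨j, hj⟩
    · intro b hb
      exact Ordinal.iSup_le_iff.2 fun k => hb ⟨k, k.2, rfl⟩
  have hfe : ∀ i < e.cof.ord, f i < e := by
    intro i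
    induction i using Ordinal.limitRecOn with
    | zero => exact fun _ => f0 ▸ hd
    | add_one i ih =>
      intro hi
      have hi' := (Order.lt_add_one_iff.2 le_rfl).trans hi
      rw [f1]
      refine he.add_one_lt (max_lt (ih hi') (max_lt (hc _ (ih hi')) ?_))
      simp only [h, dif_pos hi']
      exact (g ⟨i, hi'⟩).2
    | limit i hi ih =>
      intro hi'
      rw [f2 i hi]
      exact iSup_Iio_lt_of_card_lt_cof (Cardinal.lt_ord.1 hi') fun j => ih j j.2 (j.2.trans hi')
  refine ⟨f, hfn, f0, hfe, fun i => ⟨_, f1 i⟩, fun i => lt1 i _ (by simp), fun β hβ => ?_⟩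
  obtain ⟨_, ⟨⟨i, hi⟩, rfl⟩, hle⟩ := hg.isCofinal_range ⟨β, hβ⟩
  refine ⟨i + 1, hcof.add_one_lt hi, lt1 i _ (le_trans hle ?_)⟩
  rw [show h i = (g ⟨i, hi⟩).1 from dif_pos hi]
  exact (le_max_right _ _).trans (le_max_right _ _)

theorem isSuccLimit_omega1 : Order.IsSuccLimit omega1 := Cardinal.isSuccLimit_ord (aleph0_le_aleph 1)

theorem isSuccLimit_omega2 : Order.IsSuccLimit omega2 := Cardinal.isSuccLimit_ord (aleph0_le_aleph 2)

theorem isRegular_aleph_two : (ℵ_ 2 : Cardinal.{0}).IsRegular := by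
  simpa [one_add_one_eq_two] using isRegular_aleph_add_one 1

theorem isRegular_aleph1 : (ℵ_ 1 : Cardinal.{0}).IsRegular := by
  simpa using isRegular_aleph_add_one 0

theorem cof_omega2 : omega2.cof = ℵ_ 2 := isRegular_aleph_two.cof_ord

theorem cof_omega1 : omega1.cof = ℵ_ 1 := isRegular_aleph1.cof_ord

theorem omega0_lt_omega1 : ω < omega1 := by
  rw [omega1, ← Cardinal.ord_aleph0]
  exact Cardinal.ord_lt_ord.2 aleph0_lt_aleph_one

theorem omega1_lt_omega2 : omega1 < omega2 :=
  Cardinal.ord_lt_ord.2 (aleph_lt_aleph.2 one_lt_two)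

theorem isSuccLimit_of_cof_eq_aleph {e : Ordinal.{0}} {c : Cardinal.{0}} (h : e.cof = c)
    (hc : ℵ₀ ≤ c) : Order.IsSuccLimit e :=
  one_lt_cof_iff.1 (h ▸ one_lt_aleph0.trans_le hc)

/-- Any ordinal below `ω₂` is zero, a successor, or has cofinality `ω` or `ω₁`. -/
theorem cof_of_lt_omega2 {e : Ordinal.{0}} (he : e < omega2) (hl : Order.IsSuccLimit e) :
    e.cof = ℵ₀ ∨ e.cof = ℵ_ 1 := by
  have h1 : e.cof < ℵ_ 2 := (Ordinal.cof_le_card e).trans_lt (Cardinal.lt_ord.1 he)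
  have h2 : ℵ₀ ≤ e.cof := aleph0_le_cof_iff.2 (one_lt_cof_iff.2 hl)
  rcases h2.lt_or_eq with h | h
  · right
    refine le_antisymm ?_ ?_
    · rw [← Order.lt_succ_iff, succ_aleph]
      simpa [one_add_one_eq_two] using h1
    · rw [← succ_aleph0]
      exact Order.succ_le_of_lt h
  · exact Or.inl h.symm

/-- The next element of an unbounded set. -/
theorem UnbddIn.exists_next {C : Set Ordinal.{0}} {e : Ordinal.{0}} (h : UnbddIn C e) :
    ∃ c : Ordinal.{0} → Ordinal.{0}, ∀ x < e, c x ∈ C ∧ x < c x ∧ c x < e := by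
  choose! c hc using h
  exact ⟨c, hc⟩

/-- A normal function which skips over elements of a closed set takes limits into this set. -/
theorem ClosedIn.map_limit_mem {C : Set Ordinal.{0}} {e : Ordinal.{0}} (h : ClosedIn C e)
    {f : Ordinal.{0} → Ordinal.{0}} (hf : Order.IsNormal f) {i : Ordinal.{0}}
    (hi : Order.IsSuccLimit i) (hie : f i < e) (hC : ∀ j < i, ∃ γ ∈ C, f j < γ ∧ γ < f (j + 1)) :
    f i ∈ C := by
  refine h _ hie ?_ fun β hβ => ?_
  · have := hf.strictMono hi.bot_lt
    exact (this.trans_le' bot_le).ne'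
  · obtain ⟨j, hj, hβj⟩ := (hf.lt_iff_exists_lt hi).1 hβ
    obtain ⟨γ, hγ, h1, h2⟩ := hC j hj
    exact ⟨γ, hγ, hβj.trans h1, h2.trans (hf.strictMono (hi.add_one_lt hj))⟩

/-- The intersection of two closed unbounded subsets of `ω₂` contains a point of
cofinality `ω₁`. -/
theorem exists_mem_S21_of_club {C D : Set Ordinal.{0}} (hC : ClosedIn C omega2)
    (hC' : UnbddIn C omega2) (hD : ClosedIn D omega2) (hD' : UnbddIn D omega2) :
    ∃ α ∈ S21, α ∈ C ∧ α ∈ D := by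
  obtain ⟨c, hc⟩ := hC'.exists_next
  obtain ⟨c', hc'⟩ := hD'.exists_next
  obtain ⟨f, hf, -, hfe, -, hcf, -⟩ := exists_isNormal_cofinal isSuccLimit_omega2
    isSuccLimit_omega2.bot_lt (fun x => max (c x) (c' x)) fun x hx => max_lt (hc x hx).2.2 (hc' x hx).2.2
  have hlt : omega1 < omega2.cof.ord := by rw [cof_omega2]; exact omega1_lt_omega2
  refine ⟨f omega1, ⟨hfe _ hlt, ?_⟩, ?_, ?_⟩
  · rw [cof_map_of_isNormal hf isSuccLimit_omega1, cof_omega1]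
  · refine hC.map_limit_mem hf isSuccLimit_omega1 (hfe _ hlt) fun j hj => ?_
    obtain ⟨h1, h2, -⟩ := hc (f j) (hfe j (hj.trans hlt))
    exact ⟨_, h1, h2, (le_max_left _ _).trans_lt (hcf j)⟩
  · refine hD.map_limit_mem hf isSuccLimit_omega1 (hfe _ hlt) fun j hj => ?_
    obtain ⟨h1, h2, -⟩ := hc' (f j) (hfe j (hj.trans hlt))
    exact ⟨_, h1, h2, (le_max_right _ _).trans_lt (hcf j)⟩

/-! ### Ordinal-indexed sums of copies of `Theta` -/

/-- The sum of copies of `Theta` indexed by the interval `[d, e)`, with a point added in front of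
the copies with index in `S`. -/
def Seg (S : Set Ordinal.{0}) (d e : Ordinal.{0}) : Set (Ordinal.{0} ×ₗ WithBot Theta) :=
  {p | d ≤ (ofLex p).1 ∧ (ofLex p).1 < e ∧ ((ofLex p).2 = ⊥ → (ofLex p).1 ∈ S)}

namespace Seg

variable {S T : Set Ordinal.{0}} {d e : Ordinal.{0}}

theorem monotone_fst {P : Set (Ordinal.{0} ×ₗ WithBot Theta)} :
    Monotone fun p : P => (ofLex p.1).1 :=
  fun _ _ h => Prod.Lex.monotone_fst _ _ h

theorem congr_set (h : ∀ x, d ≤ x → x < e → (x ∈ S ↔ x ∈ T)) : Seg S d e = Seg T d e := by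
  ext p
  exact and_congr_right fun h1 => and_congr_right fun h2 => by rw [h _ h1 h2]

/-- A subtype of a set, described as another set. -/
theorem orderIso_subtype {X : Type*} [LinearOrder X] {P : Set X} (r : P → Prop) (Q : Set X)
    (h : ∀ x, x ∈ Q ↔ ∃ hx : x ∈ P, r ⟨x, hx⟩) : Nonempty ({p : P // r p} ≃o Q) :=
  nonempty_orderIso_of_strictMono
    (fun p => ⟨p.1.1, (h _).2 ⟨p.1.2, p.2⟩⟩) (fun _ _ h => h) fun x =>
    ⟨⟨⟨x.1, ((h _).1 x.2).1⟩, ((h _).1 x.2).2⟩, rfl⟩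

theorem block_one : Theta.block 1 = Seg ∅ 0 omega1 := by
  ext p
  by_cases h : (ofLex p).2 = ⊥ <;> simp [Theta.block, Seg, IsMarked, h]

theorem block_two : Theta.block 2 = Seg {i | Order.IsSuccLimit i} 0 omega1 := by
  ext p
  by_cases h : (ofLex p).2 = ⊥ <;> simp [Theta.block, Seg, IsMarked, h]

theorem singleton (hd : d ∉ S) : Nonempty (Seg S d (d + 1) ≃o Theta) := by
  have mem : ∀ w : Theta, toLex (d, (w : WithBot Theta)) ∈ Seg S d (d + 1) := fun w =>
    ⟨le_rfl, Order.lt_add_one_iff.2 le_rfl, fun h => (WithBot.coe_ne_bot h).elim⟩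
  obtain ⟨F⟩ := nonempty_orderIso_of_strictMono (X := Theta) (Y := Seg S d (d + 1))
    (fun w => ⟨_, mem w⟩) (fun w w' h => by
      refine Prod.Lex.lt_iff.2 (Or.inr ⟨rfl, WithBot.coe_lt_coe.2 h⟩)) (by
    rintro ⟨⟨i, z⟩, h1, h2, h3⟩
    obtain rfl : d = i := le_antisymm h1 (Order.lt_add_one_iff.1 h2)
    induction z using WithBot.recBotCoe with
    | bot => exact (hd (h3 rfl)).elim
    | coe w => exact ⟨w, rfl⟩)
  exact ⟨F.symm⟩

/-- Splitting off the point added in front of the whole sum. -/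
theorem piece {i : Ordinal.{0}} (hde : d < e) (hθ : Nonempty (Seg (S \ {d}) d e ≃o Theta))
    (h : d ∈ S ↔ i ∈ T) : Nonempty (Seg S d e ≃o Seg T i (i + 1)) := by
  have hi : i < i + 1 := Order.lt_add_one_iff.2 le_rfl
  have key : ∀ {S : Set Ordinal.{0}} {d e : Ordinal.{0}}, d < e → ∃ a : Seg S d e → Prop,
      Monotone a ∧ Nonempty ({p // a p = False} ≃o {u : Unit | d ∈ S}) ∧
      Nonempty ({p // a p = True} ≃o Seg (S \ {d}) d e) := by
    intro S d e hde
    refine ⟨fun p => p.1 ≠ toLex (d, ⊥), ?_, ?_, ?_⟩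
    · rintro ⟨p, hp1, hp2, hp3⟩ ⟨q, hq1, hq2, hq3⟩ hpq hp hq
      obtain rfl : q = toLex (d, ⊥) := hq
      refine hp (le_antisymm hpq (Prod.Lex.le_iff.2 ?_))
      rcases hp1.lt_or_eq with h | h
      · exact Or.inl h
      · exact Or.inr ⟨h, bot_le⟩
    · refine nonempty_orderIso_of_strictMono (fun p => ⟨(), ?_⟩) ?_ ?_
      · have h : p.1.1 = toLex (d, ⊥) := by simpa using p.2
        have := p.1.2.2.2
        rw [h] at this
        exact this rfl
      · intro p q h
        have h1 : p.1.1 = toLex (d, ⊥) := by simpa using p.2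
        have h2 : q.1.1 = toLex (d, ⊥) := by simpa using q.2
        have h3 : p.1.1 < q.1.1 := h
        rw [h1, h2] at h3
        exact (lt_irrefl _ h3).elim
      · rintro ⟨u, hu⟩
        exact ⟨⟨⟨toLex (d, ⊥), le_rfl, hde, fun _ => hu⟩, by simp⟩, rfl⟩
    · refine orderIso_subtype _ _ fun p => ⟨fun hp => ?_, ?_⟩
      · refine ⟨⟨hp.1, hp.2.1, fun h => (hp.2.2 h).1⟩, eq_true ?_⟩
        rintro rfl
        exact (hp.2.2 rfl).2 rfl
      · rintro ⟨hp, hne⟩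
        refine ⟨hp.1, hp.2.1, fun h => ⟨hp.2.2 h, fun h' => of_eq_true hne ?_⟩⟩
        exact Prod.ext h' h
  obtain ⟨a, ha, ⟨F⟩, ⟨G⟩⟩ := key (S := S) hde
  obtain ⟨b, hb, ⟨F'⟩, ⟨G'⟩⟩ := key (S := T) hi
  obtain ⟨H⟩ := hθ
  obtain ⟨H'⟩ := singleton (S := T \ {i}) (d := i) (by simp)
  refine orderIso_of_fibers a ha b hb fun x => ?_
  by_cases hx : x
  · rw [eq_true hx]
    exact ⟨G.trans (H.trans (H'.symm.trans G'.symm))⟩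
  · rw [eq_false hx]
    exact ⟨F.trans ((OrderIso.setCongr _ _ (by simp [h])).trans F'.symm)⟩

/-- Sums split along normal functions. -/
theorem glue {l : Ordinal.{0}} {f : Ordinal.{0} → Ordinal.{0}} (hf : Order.IsNormal f)
    (hl : Order.IsSuccLimit l) (hfe : ∀ i < l, f i < e) (hcof : ∀ β < e, ∃ i < l, β < f i)
    (hp : ∀ i < l, Nonempty (Seg S (f i) (f (i + 1)) ≃o Seg T i (i + 1))) :
    Nonempty (Seg S (f 0) e ≃o Seg T 0 l) := by
  have hidx : ∀ x, f 0 ≤ x → ∃ i, f i ≤ x ∧ x < f (i + 1) := fun x hx =>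
    hf.exists_map_le_lt_map_succ_of_exists_ge ⟨x, hf.strictMono.le_apply⟩ hx
  choose! a ha using hidx
  have ha' : ∀ x i, f i ≤ x → x < f (i + 1) → a x = i := by
    intro x i h1 h2
    obtain ⟨h3, h4⟩ := ha x ((hf.strictMono.monotone bot_le).trans h1)
    exact le_antisymm (Order.lt_add_one_iff.1 (hf.strictMono.lt_iff_lt.1 (h3.trans_lt h2)))
      (Order.lt_add_one_iff.1 (hf.strictMono.lt_iff_lt.1 (h1.trans_lt h4)))
  refine orderIso_of_fibers (fun p => a (ofLex p.1).1) (fun p q hpq => ?_)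
    (fun p => (ofLex p.1).1) monotone_fst fun i => ?_
  · have h1 := ha _ p.2.1
    have h2 := ha _ q.2.1
    exact Order.lt_add_one_iff.1
      (hf.strictMono.lt_iff_lt.1 ((h1.1.trans (monotone_fst hpq)).trans_lt h2.2))
  · by_cases hi : i < l
    · obtain ⟨F⟩ := orderIso_subtype (P := Seg S (f 0) e) (fun p => a (ofLex p.1).1 = i)
        (Seg S (f i) (f (i + 1))) fun p => by
          constructor
          · rintro ⟨h1, h2, h3⟩
            exact ⟨⟨(hf.strictMono.monotone bot_le).trans h1,
              h2.trans (hfe _ (hl.add_one_lt hi)), h3⟩, ha' _ _ h1 h2⟩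
          · rintro ⟨⟨h1, h2, h3⟩, rfl⟩
            exact ⟨(ha _ h1).1, (ha _ h1).2, h3⟩
      obtain ⟨G⟩ := orderIso_subtype (P := Seg T 0 l) (fun p => (ofLex p.1).1 = i)
        (Seg T i (i + 1)) fun p => by
          constructor
          · rintro ⟨h1, h2, h3⟩
            have := le_antisymm (Order.lt_add_one_iff.1 h2) h1
            exact ⟨⟨bot_le, this.trans_lt hi, h3⟩, this⟩
          · rintro ⟨⟨h1, h2, h3⟩, rfl⟩
            exact ⟨le_rfl, Order.lt_add_one_iff.2 le_rfl, h3⟩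
      obtain ⟨H⟩ := hp i hi
      exact ⟨F.trans (H.trans G.symm)⟩
    · have : IsEmpty {p : Seg S (f 0) e // a (ofLex p.1).1 = i} := by
        refine ⟨?_⟩
        rintro ⟨⟨p, h1, h2, h3⟩, rfl⟩
        obtain ⟨j, hj, hlt⟩ := hcof _ h2
        exact hi ((hf.strictMono.lt_iff_lt.1 ((ha _ h1).1.trans_lt hlt)).trans hj)
      have : IsEmpty {p : Seg T 0 l // (ofLex p.1).1 = i} := by
        refine ⟨?_⟩
        rintro ⟨⟨p, h1, h2, h3⟩, rfl⟩
        exact hi h2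
      exact nonempty_orderIso_of_strictMono isEmptyElim (fun p => isEmptyElim p) fun p =>
        isEmptyElim p

theorem theta_of_three {M : Type*} [LinearOrder M] (a : M → Fin 3) (ha : Monotone a)
    (h0 : Nonempty ({m // a m = 0} ≃o Theta)) (h2 : Nonempty ({m // a m = 2} ≃o Theta))
    (h1 : IsEmpty {m // a m = 1} ∨ ∃ k, Nonempty ({m // a m = 1} ≃o Theta.block k)) :
    Nonempty (M ≃o Theta) := by
  refine Theta.orderIso_of_countable_sum a ha {0, 2} ?_ ?_ ?_ ?_ ?_
  · rintro _ (rfl | rfl)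
    exacts [h0, h2]
  · intro e he
    obtain rfl : e = 1 := by
      fin_cases e <;> simp_all
    exact h1
  · exact fun e => ⟨0, by simp, bot_le⟩
  · exact fun e => ⟨2, by simp, le_top (α := Fin 3)⟩
  · intro e e' hlt he he'
    fin_cases e <;> fin_cases e' <;> simp_all

theorem theta_omega : Nonempty (Seg ∅ 0 ω ≃o Theta) := by
  have : Countable (Iio (ω : Ordinal.{0})) := by
    rw [← Cardinal.mk_le_aleph0_iff, Cardinal.mk_Iio_ordinal]
    simp
  have : Nonempty (Iio (ω : Ordinal.{0})) := ⟨⟨0, omega0_pos⟩⟩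
  refine Theta.orderIso_of_countable_sum (E := Iio (ω : Ordinal.{0}))
    (fun p : Seg ∅ 0 ω => ⟨(ofLex p.1).1, p.2.2.1⟩) (fun p q h => monotone_fst h) univ
    (fun i _ => ?_) (by simp) (fun i => ⟨i, by simp⟩) (fun i => ⟨i, by simp⟩) (by simp)
  obtain ⟨F⟩ := singleton (S := ∅) (d := i.1) (by simp)
  obtain ⟨G⟩ := orderIso_subtype (P := Seg ∅ 0 ω)
    (fun p => (⟨(ofLex p.1).1, p.2.2.1⟩ : Iio (ω : Ordinal.{0})) = i) (Seg ∅ i.1 (i.1 + 1)) fun p => by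
      constructor
      · rintro ⟨h1, h2, h3⟩
        have := le_antisymm (Order.lt_add_one_iff.1 h2) h1
        exact ⟨⟨bot_le, this.trans_lt i.2, h3⟩, Subtype.ext this⟩
      · rintro ⟨⟨h1, h2, h3⟩, rfl⟩
        exact ⟨le_rfl, Order.lt_add_one_iff.2 le_rfl, h3⟩
  exact ⟨G.trans F⟩

end Seg

/-! ### Initial sums of a non-reflecting set -/

namespace Seg

variable {S : Set Ordinal.{0}} {d e : Ordinal.{0}}

theorem cof_ord_eq_omega1 (he : e.cof = ℵ_ 1) : e.cof.ord = omega1 := congrArg Cardinal.ord he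

theorem cof_eq_aleph0_of_lt_omega1 {i : Ordinal.{0}} (hi : Order.IsSuccLimit i) (h : i < omega1) :
    i.cof = ℵ₀ :=
  cof_eq_aleph0_of_isSuccLimit hi (by rwa [omega1, ord_aleph] at h)

theorem add_one_not_mem_S20 (x : Ordinal.{0}) : x + 1 ∉ S20 := fun h => by
  have := h.2
  rw [cof_add_one] at this
  exact one_lt_aleph0.ne this

theorem orderIso_of_club (hS : S ⊆ S20) (he2 : e < omega2) (he : e.cof = ℵ_ 1) (hde : d < e)
    (ih : ∀ d e', d < e' → e' < e → e'.cof ≠ ℵ_ 1 → Nonempty (Seg (S \ {d}) d e' ≃o Theta))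
    {C : Set Ordinal.{0}} (hC : ClosedIn C e) (hC' : UnbddIn C e) (T : Set Ordinal.{0})
    (hT : ∀ i ∈ T, Order.IsSuccLimit i)
    (hST : ∀ x ∈ C, ∀ i, Order.IsSuccLimit i → x ∈ S20 → (x ∈ S ↔ i ∈ T)) :
    Nonempty (Seg (S \ {d}) d e ≃o Seg T 0 omega1) := by
  obtain ⟨c, hc⟩ := hC'.exists_next
  have hle := isSuccLimit_of_cof_eq_aleph he (aleph0_le_aleph 1)
  obtain ⟨f, hf, f0, hfe, hf1, hcf, hcof⟩ := exists_isNormal_cofinal hle hde c fun x hx => (hc x hx).2.2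
  rw [cof_ord_eq_omega1 he] at hfe hcof
  have hpiece : ∀ i < omega1, Nonempty (Seg (S \ {d}) (f i) (f (i + 1)) ≃o Seg T i (i + 1)) := by
    intro i hi
    have hlt : f i < f (i + 1) := hf.strictMono (Order.lt_add_one_iff.2 le_rfl)
    have hdi : d ≤ f i := f0 ▸ hf.strictMono.monotone bot_le
    refine piece hlt ?_ ?_
    · obtain ⟨x, hx⟩ := hf1 i
      have h := ih (f i) (f (i + 1)) hlt (hfe _ (isSuccLimit_omega1.add_one_lt hi)) (by
        rw [hx, cof_add_one]
        exact (one_lt_aleph0.trans_le (aleph0_le_aleph 1)).ne)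
      rwa [congr_set (S := (S \ {d}) \ {f i}) (T := S \ {f i})]
      intro y h1 h2
      simp only [mem_sdiff, mem_singleton_iff]
      exact ⟨fun h => ⟨h.1.1, h.2⟩, fun h => ⟨⟨h.1, (hdi.trans_lt (h1.lt_of_ne (Ne.symm h.2))).ne'⟩,
        h.2⟩⟩
    · rcases zero_or_succ_or_isSuccLimit i with rfl | ⟨j, rfl⟩ | hil
      · rw [f0]
        exact iff_of_false (by simp) fun h => (hT _ h).ne_bot rfl
      · obtain ⟨x, hx⟩ := hf1 j
        refine iff_of_false (fun h => add_one_not_mem_S20 x ?_) fun h => ?_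
        · rw [← hx]
          exact hS h.1
        · exact Order.not_isSuccLimit_succ _ (hT _ h)
      · have hiC := hC.map_limit_mem hf hil (hfe i hi) fun j hj => by
          obtain ⟨h1, h2, -⟩ := hc (f j) (hfe j (hj.trans hi))
          exact ⟨_, h1, h2, hcf j⟩
        have h20 : f i ∈ S20 := ⟨(hfe i hi).trans he2, by
          rw [cof_map_of_isNormal hf hil, cof_eq_aleph0_of_lt_omega1 hil hi]⟩
        have hne : f i ≠ d := (f0 ▸ hf.strictMono hil.bot_lt : d < f i).ne'
        rw [← hST _ hiC i hil h20]
        simp [hne]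
  have := glue hf isSuccLimit_omega1 hfe hcof hpiece
  rwa [f0] at this

theorem exists_club_of_not_stationaryIn {X : Set Ordinal.{0}} (h : ¬ StationaryIn (X ∩ Iio e) e) :
    ∃ C, ClosedIn C e ∧ UnbddIn C e ∧ ∀ x ∈ C, x ∉ X := by
  simp only [StationaryIn, not_forall, not_nonempty_iff_eq_empty] at h
  obtain ⟨C, hCe, hC, hC', h⟩ := h
  exact ⟨C, hC, hC', fun x hx hX => h.subset (show x ∈ X ∩ Iio e ∩ C from ⟨⟨hX, hCe hx⟩, hx⟩)⟩

theorem orderIso_block_one (hS : S ⊆ S20) (he : e ∈ S21) (hde : d < e)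
    (ih : ∀ d e', d < e' → e' < e → e'.cof ≠ ℵ_ 1 → Nonempty (Seg (S \ {d}) d e' ≃o Theta))
    (h : ¬ StationaryIn (S ∩ Iio e) e) : Nonempty (Seg (S \ {d}) d e ≃o Theta.block 1) := by
  obtain ⟨C, hC, hC', hCS⟩ := exists_club_of_not_stationaryIn h
  rw [block_one]
  exact orderIso_of_club hS he.1 he.2 hde ih hC hC' ∅ (by simp) fun x hx _ _ _ => by
    simp [hCS x hx]

theorem orderIso_block_two (hS : S ⊆ S20) (he : e ∈ S21) (hde : d < e)
    (ih : ∀ d e', d < e' → e' < e → e'.cof ≠ ℵ_ 1 → Nonempty (Seg (S \ {d}) d e' ≃o Theta))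
    (h : ¬ StationaryIn ((S20 \ S) ∩ Iio e) e) :
    Nonempty (Seg (S \ {d}) d e ≃o Theta.block 2) := by
  obtain ⟨C, hC, hC', hCS⟩ := exists_club_of_not_stationaryIn h
  rw [block_two]
  exact orderIso_of_club hS he.1 he.2 hde ih hC hC' _ (fun _ h => h) fun x hx i hi h20 =>
    iff_of_true (by_contra fun h => hCS x hx ⟨h20, h⟩) hi

theorem orderIso_of_successor (hS : S ⊆ S20) (he : e < omega2)
    (hnr : e.cof = ℵ_ 1 → ¬ StationaryIn (S ∩ Iio e) e ∨ ¬ StationaryIn ((S20 \ S) ∩ Iio e) e)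
    (ih : ∀ d e', d < e' → e' < e + 1 → e'.cof ≠ ℵ_ 1 → Nonempty (Seg (S \ {d}) d e' ≃o Theta))
    (hde : d ≤ e) : Nonempty (Seg (S \ {d}) d (e + 1) ≃o Theta) := by
  have he1 : e < e + 1 := Order.lt_add_one_iff.2 le_rfl
  rcases hde.eq_or_lt with rfl | hde
  · exact singleton (by simp)
  by_cases hcof : e.cof = ℵ_ 1
  · have hle := isSuccLimit_of_cof_eq_aleph hcof (aleph0_le_aleph 1)
    have hd1 : d + 1 < e := hle.add_one_lt hde
    have hd : d < d + 1 := Order.lt_add_one_iff.2 le_rfl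
    have heS : e ∉ S := fun h => by
      have := (hS h).2
      rw [hcof] at this
      exact aleph0_lt_aleph_one.ne' this
    have hd1S : d + 1 ∉ S := fun h => add_one_not_mem_S20 d (hS h)
    let r : Ordinal.{0} → Fin 3 := fun x => if x < d + 1 then 0 else if x < e then 1 else 2
    have r0 : ∀ x, r x = 0 ↔ x < d + 1 := fun x => by
      simp only [r]; split_ifs <;> simp_all
    have r1 : ∀ x, r x = 1 ↔ d + 1 ≤ x ∧ x < e := fun x => by
      simp only [r]; split_ifs <;> simp_all
    have r2 : ∀ x, r x = 2 ↔ e ≤ x := fun x => by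
      simp only [r]; split_ifs with h1 h2
      · simpa using h1.trans hd1
      · simpa using h2
      · simpa using h2
    have hr : Monotone r := by
      intro x y hxy
      rcases lt_or_ge y (d + 1) with h | h
      · rw [(r0 y).2 h, (r0 x).2 (hxy.trans_lt h)]
      rcases lt_or_ge y e with h' | h'
      · rw [(r1 y).2 ⟨h, h'⟩]
        simp only [r, hxy.trans_lt h', if_true]
        split_ifs <;> simp
      · rw [(r2 y).2 h']
        exact le_top (α := Fin 3)
    refine theta_of_three (fun p : Seg (S \ {d}) d (e + 1) => r (ofLex p.1).1)
      (hr.comp monotone_fst) ?_ ?_ (Or.inr ?_)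
    · obtain ⟨F⟩ := orderIso_subtype (P := Seg (S \ {d}) d (e + 1)) (fun p => r (ofLex p.1).1 = 0)
        (Seg (S \ {d}) d (d + 1)) fun p => by
          simp only [r0]
          exact ⟨fun ⟨h1, h2, h3⟩ => ⟨⟨h1, h2.trans (hd1.trans he1), h3⟩, h2⟩,
            fun ⟨⟨h1, h2, h3⟩, h4⟩ => ⟨h1, h4, h3⟩⟩
      obtain ⟨G⟩ := singleton (S := S \ {d}) (d := d) (by simp)
      exact ⟨F.trans G⟩
    · obtain ⟨F⟩ := orderIso_subtype (P := Seg (S \ {d}) d (e + 1)) (fun p => r (ofLex p.1).1 = 2)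
        (Seg (S \ {d}) e (e + 1)) fun p => by
          simp only [r2]
          exact ⟨fun ⟨h1, h2, h3⟩ => ⟨⟨hde.le.trans h1, h2, h3⟩, h1⟩,
            fun ⟨⟨h1, h2, h3⟩, h4⟩ => ⟨h4, h2, h3⟩⟩
      obtain ⟨G⟩ := singleton (S := S \ {d}) (d := e) (by simp [heS])
      exact ⟨F.trans G⟩
    · obtain ⟨F⟩ := orderIso_subtype (P := Seg (S \ {d}) d (e + 1)) (fun p => r (ofLex p.1).1 = 1)
        (Seg (S \ {d + 1}) (d + 1) e) fun p => by
          simp only [r1]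
          constructor
          · rintro ⟨h1, h2, h3⟩
            exact ⟨⟨hd.le.trans h1, h2.trans he1, fun h => ⟨(h3 h).1, (hd.trans_le h1).ne'⟩⟩, h1, h2⟩
          · rintro ⟨⟨h1, h2, h3⟩, h4, h5⟩
            exact ⟨h4, h5, fun h => ⟨(h3 h).1, fun h' => hd1S (h' ▸ (h3 h).1)⟩⟩
      have ih' : ∀ d e', d < e' → e' < e → e'.cof ≠ ℵ_ 1 → Nonempty (Seg (S \ {d}) d e' ≃o Theta) :=
        fun d e' h1 h2 => ih d e' h1 (h2.trans he1)
      rcases hnr hcof with h | h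
      · obtain ⟨G⟩ := orderIso_block_one hS ⟨he, hcof⟩ hd1 ih' h
        exact ⟨1, ⟨F.trans G⟩⟩
      · obtain ⟨G⟩ := orderIso_block_two hS ⟨he, hcof⟩ hd1 ih' h
        exact ⟨2, ⟨F.trans G⟩⟩
  · let r : Ordinal.{0} × WithBot Theta → Fin 3 := fun p =>
      if p.1 < e then 0 else if p.2 = ⊥ then 1 else 2
    have r0 : ∀ p, r p = 0 ↔ p.1 < e := fun p => by
      simp only [r]; split_ifs <;> simp_all
    have r1 : ∀ p, r p = 1 ↔ e ≤ p.1 ∧ p.2 = ⊥ := fun p => by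
      simp only [r]; split_ifs <;> simp_all
    have r2 : ∀ p, r p = 2 ↔ e ≤ p.1 ∧ p.2 ≠ ⊥ := fun p => by
      simp only [r]; split_ifs <;> simp_all
    refine theta_of_three (fun p : Seg (S \ {d}) d (e + 1) => r (ofLex p.1)) ?_ ?_ ?_ ?_
    · intro p q hpq
      rcases Prod.Lex.le_iff.1 (show p.1 ≤ q.1 from hpq) with h | ⟨h, h'⟩
      · have : (ofLex p.1).1 < e := h.trans_le (Order.lt_add_one_iff.1 q.2.2.1)
        simp [r, this]
      · simp only [r, h]
        split_ifs with h1 h2 h3 h4 <;> simp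
        rw [h4, le_bot_iff] at h'
        exact h2 h'
    · obtain ⟨F⟩ := orderIso_subtype (P := Seg (S \ {d}) d (e + 1)) (fun p => r (ofLex p.1) = 0)
        (Seg (S \ {d}) d e) fun p => by
          simp only [r0]
          exact ⟨fun ⟨h1, h2, h3⟩ => ⟨⟨h1, h2.trans he1, h3⟩, h2⟩,
            fun ⟨⟨h1, h2, h3⟩, h4⟩ => ⟨h1, h4, h3⟩⟩
      obtain ⟨G⟩ := ih d e hde he1 hcof
      exact ⟨F.trans G⟩
    · obtain ⟨F⟩ := orderIso_subtype (P := Seg (S \ {d}) d (e + 1)) (fun p => r (ofLex p.1) = 2)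
        (Seg ∅ e (e + 1)) fun p => by
          simp only [r2]
          exact ⟨fun ⟨h1, h2, h3⟩ => ⟨⟨hde.le.trans h1, h2, fun h => (h3 h).elim⟩, h1, h3⟩,
            fun ⟨⟨h1, h2, h3⟩, h4, h5⟩ => ⟨h4, h2, fun h => (h5 h).elim⟩⟩
      obtain ⟨G⟩ := singleton (S := ∅) (d := e) (by simp)
      exact ⟨F.trans G⟩
    · have heq : ∀ p : Seg (S \ {d}) d (e + 1), r (ofLex p.1) = 1 → p.1 = toLex (e, ⊥) := by
        intro p hp
        rw [r1] at hp
        exact Prod.ext (le_antisymm (Order.lt_add_one_iff.1 p.2.2.1) hp.1) hp.2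
      by_cases heS : e ∈ S
      · right
        have he' : toLex (e, ⊥) ∈ Seg (S \ {d}) d (e + 1) :=
          ⟨hde.le, he1, fun _ => ⟨heS, hde.ne'⟩⟩
        have h0 : toLex ((0 : Ordinal.{0}), (⊥ : WithBot Theta)) ∈ Theta.block 0 := by
          simp [Theta.block, IsMarked]
        refine ⟨0, nonempty_orderIso_of_strictMono (fun _ => ⟨_, h0⟩) ?_ ?_⟩
        · intro p q h
          have h : p.1.1 < q.1.1 := h
          rw [heq _ p.2, heq _ q.2] at h
          exact (lt_irrefl _ h).elim
        · rintro ⟨p, h1, h2⟩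
          refine ⟨⟨⟨_, he'⟩, by rw [r1]; exact ⟨le_rfl, rfl⟩⟩, Subtype.ext ?_⟩
          by_cases h : (ofLex p).2 = ⊥
          · have := h1 h
            simp only [IsMarked, if_pos] at this
            exact (Prod.ext this.1 h : ofLex p = (0, ⊥)).symm
          · simpa [IsMarked] using h2 h
      · left
        refine ⟨fun p => ?_⟩
        have h := p.1.2.2.2
        rw [heq _ p.2] at h
        exact heS (h rfl).1

/-- Initial and other segments not of cofinality `ω₁` of a non-reflecting sum are isomorphic to
`Theta`. -/
theorem orderIso_theta (hS : S ⊆ S20)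
    (hnr : ∀ e ∈ S21, ¬ StationaryIn (S ∩ Iio e) e ∨ ¬ StationaryIn ((S20 \ S) ∩ Iio e) e)
    (e : Ordinal.{0}) : e < omega2 → e.cof ≠ ℵ_ 1 → ∀ d < e, Nonempty (Seg (S \ {d}) d e ≃o Theta) := by
  induction e using WellFoundedLT.induction with
  | ind e ih =>
    intro he hcof d hde
    rcases zero_or_succ_or_isSuccLimit e with rfl | ⟨e, rfl⟩ | hl
    · exact (not_lt_bot hde).elim
    · rw [Order.succ_eq_add_one] at *
      have he' := (Order.lt_add_one_iff.2 le_rfl : e < e + 1).trans he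
      exact orderIso_of_successor hS he' (fun h => hnr e ⟨he', h⟩)
        (fun d e' h1 h2 h3 => ih e' h2 (h2.trans he) h3 d h1) (Order.lt_add_one_iff.1 hde)
    · have hcof' := (cof_of_lt_omega2 he hl).resolve_right hcof
      obtain ⟨f, hf, f0, hfe, hf1, -, hcf⟩ := exists_isNormal_cofinal hl hde id fun _ h => h
      rw [show e.cof.ord = ω by rw [hcof', ord_aleph0]] at hfe hcf
      have h1 : ∀ i < ω, f i ∉ S \ {d} := by
        intro i hi
        rcases zero_or_succ_or_isSuccLimit i with rfl | ⟨j, rfl⟩ | hil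
        · simp [f0]
        · obtain ⟨x, hx⟩ := hf1 j
          intro h
          refine add_one_not_mem_S20 x ?_
          rw [← hx]
          exact hS h.1
        · exact (hi.not_ge (omega0_le_of_isSuccLimit hil)).elim
      obtain ⟨F⟩ := glue (S := S \ {d}) (T := ∅) hf isSuccLimit_omega0 hfe hcf fun i hi => by
        have hlt : f i < f (i + 1) := hf.strictMono (Order.lt_add_one_iff.2 le_rfl)
        refine piece hlt ?_ (by simpa using h1 i hi)
        have hlt' := hfe _ (isSuccLimit_omega0.add_one_lt hi)
        obtain ⟨x, hx⟩ := hf1 i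
        have h := ih _ hlt' (hlt'.trans he) (by
          rw [hx, cof_add_one]
          exact (one_lt_aleph0.trans_le (aleph0_le_aleph 1)).ne) (f i) hlt
        rwa [congr_set (S := (S \ {d}) \ {f i}) (T := S \ {f i})]
        intro y h1 h2
        have hdi : d ≤ f i := f0 ▸ hf.strictMono.monotone bot_le
        simp only [mem_sdiff, mem_singleton_iff]
        exact ⟨fun h => ⟨h.1.1, h.2⟩,
          fun h => ⟨⟨h.1, (hdi.trans_lt (h1.lt_of_ne (Ne.symm h.2))).ne'⟩, h.2⟩⟩
      rw [f0] at F
      obtain ⟨G⟩ := theta_omega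
      exact ⟨F.trans G⟩

/-- At points of cofinality `ω₁` where `S` is non-stationary, the initial sum with the points of `S`
is isomorphic to the one without any points. -/
theorem orderIso_empty (hS : S ⊆ S20)
    (hnr : ∀ e ∈ S21, ¬ StationaryIn (S ∩ Iio e) e ∨ ¬ StationaryIn ((S20 \ S) ∩ Iio e) e)
    {e : Ordinal.{0}} (he : e ∈ S21) (h : ¬ StationaryIn (S ∩ Iio e) e) :
    Nonempty (Seg S 0 e ≃o Seg ∅ 0 e) := by
  have hempty : ∀ e ∈ S21, ¬ StationaryIn (∅ ∩ Iio e) e := fun e he h => by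
    have hl := isSuccLimit_of_cof_eq_aleph he.2 (aleph0_le_aleph 1)
    obtain ⟨x, hx, -⟩ := h (Iio e) subset_rfl (fun α hα _ _ => hα) fun β hβ =>
      ⟨β + 1, hl.add_one_lt hβ, Order.lt_add_one_iff.2 le_rfl, hl.add_one_lt hβ⟩
    exact hx.1
  have h0 : (0 : Ordinal.{0}) ∉ S := fun h => by
    have := (hS h).2
    rw [cof_zero] at this
    exact aleph0_ne_zero this.symm
  have he0 : 0 < e := (isSuccLimit_of_cof_eq_aleph he.2 (aleph0_le_aleph 1)).bot_lt
  obtain ⟨F⟩ := orderIso_block_one hS he he0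
    (fun d e' h1 h2 h3 => orderIso_theta hS hnr e' (h2.trans he.1) h3 d h1) h
  obtain ⟨G⟩ := orderIso_block_one (S := ∅) (by simp) he he0
    (fun d e' h1 h2 h3 => orderIso_theta (by simp) (fun e he => Or.inl (hempty e he)) e'
      (h2.trans he.1) h3 d h1) (hempty e he)
  rw [sdiff_singleton_eq_self h0] at F
  rw [sdiff_singleton_eq_self (by simp)] at G
  exact ⟨F.trans G.symm⟩

end Seg

/-! ### Cardinalities and closure points of strategies -/

theorem mk_Iio_omega1 : #(Iio omega1) = ℵ_ 1 := by
  rw [Cardinal.mk_Iio_ordinal, omega1, Cardinal.card_ord]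
  simp

theorem mk_Iio_omega2 : #(Iio omega2) = ℵ_ 2 := by
  rw [Cardinal.mk_Iio_ordinal, omega2, Cardinal.card_ord]
  simp

theorem mk_Iio_le_aleph_one {γ : Ordinal.{0}} (h : γ < omega2) : #(Iio γ) ≤ ℵ_ 1 := by
  have h1 : γ.card < ℵ_ 2 := Cardinal.lt_ord.1 h
  have h2 : γ.card ≤ ℵ_ 1 := by
    rw [← Order.lt_succ_iff, succ_aleph]
    simpa [one_add_one_eq_two] using h1
  rw [Cardinal.mk_Iio_ordinal]
  simpa using Cardinal.lift_le.{1}.2 h2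

theorem Theta.mk_le : #Theta ≤ ℵ_ 1 := by
  let L : Set Letter := {k | (ofLex (ofLex k).2).1 < omega1}
  have hL : #L ≤ ℵ_ 1 := by
    have h : #L ≤ #(ColoredRat × Iio omega1 × Bool) :=
      Cardinal.mk_le_of_injective (f := fun k : L =>
        ((ofLex k.1).1, (⟨_, k.2⟩ : Iio omega1), (ofLex (ofLex k.1).2).2)) fun k k' h => by
          simp only [Prod.mk.injEq] at h
          exact Subtype.ext (Prod.ext h.1 (Prod.ext (Subtype.mk.inj h.2.1) h.2.2))
    refine h.trans ?_
    rw [Cardinal.mk_prod, Cardinal.mk_prod, mk_Iio_omega1]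
    simp only [Cardinal.lift_mul, Cardinal.lift_lift]
    refine Cardinal.mul_le_of_le (aleph0_le_aleph 1) ?_
      (Cardinal.mul_le_of_le (aleph0_le_aleph 1) (by simp) ?_)
    · refine le_trans ?_ (aleph0_le_aleph 1)
      simp
    · refine le_trans ?_ (aleph0_le_aleph 1)
      simp
  have hw : ∀ w, IsWord w → ∀ k ∈ w, k ∈ L := by
    intro w
    induction w with
    | nil => exact fun h => h.elim
    | cons k w ih =>
      rintro ⟨h1, h2, h3⟩ k' hk'
      rcases List.mem_cons.1 hk' with rfl | hk'
      · change (ofLex (ofLex k').2).1 < omega1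
        simp only [IsMarked] at h1
        split_ifs at h1
        · rw [h1.1]
          exact isSuccLimit_omega1.bot_lt
        · exact h1.1
        · exact h1.1
      · cases ht : (ofLex (ofLex k).2).2 with
        | true => exact ih (h2 ht) k' hk'
        | false => simp [h3 ht] at hk'
  have h : #Theta ≤ #(range (List.map ((↑) : L → Letter))) := by
    rw [Set.range_list_map_coe]
    exact Cardinal.mk_le_of_injective (f := fun w : Theta =>
      (⟨w.1, hw w.1 w.2⟩ : {l : List Letter | ∀ x ∈ l, x ∈ L})) fun w w' h =>
        Subtype.ext (Subtype.mk.inj h)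
  exact h.trans (Cardinal.mk_range_le.trans ((Cardinal.mk_list_le_max _).trans
    (max_le (aleph0_le_aleph 1) hL)))

theorem Theta.mk_withBot_le : #(WithBot Theta) ≤ ℵ_ 1 := by
  have h : #(WithBot Theta) = #Theta + 1 := Cardinal.mk_option
  rw [h]
  exact Cardinal.add_le_of_le (aleph0_le_aleph 1) Theta.mk_le
    (one_le_aleph0.trans (aleph0_le_aleph 1))

namespace Seg

variable {S : Set Ordinal.{0}}

theorem mk_le_of_fst {P : Set (Ordinal.{0} ×ₗ WithBot Theta)} {γ : Ordinal.{0}} {c : Cardinal}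
    (hc : ℵ_ 1 ≤ c) (hγ : #(Iio γ) ≤ c) (hP : ∀ p ∈ P, (ofLex p).1 < γ) : #P ≤ c := by
  have h : #P ≤ #(Iio γ × WithBot Theta) :=
    Cardinal.mk_le_of_injective (f := fun p : P => ((⟨_, hP p.1 p.2⟩ : Iio γ), (ofLex p.1).2))
      fun p q h => by
        simp only [Prod.mk.injEq] at h
        exact Subtype.ext (Prod.ext (Subtype.mk.inj h.1) h.2)
  refine h.trans ?_
  rw [Cardinal.mk_prod, Cardinal.lift_id, Cardinal.lift_id]
  exact Cardinal.mul_le_of_le ((aleph0_le_aleph 1).trans hc) hγ (Theta.mk_withBot_le.trans hc)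

theorem mk_fst_lt_le {e γ : Ordinal.{0}} (hγ : γ < omega2) :
    #{p : Seg S 0 e // (ofLex p.1).1 < γ} ≤ ℵ_ 1 := by
  obtain ⟨F⟩ := orderIso_subtype (P := Seg S 0 e) (fun p => (ofLex p.1).1 < γ)
    {p | p ∈ Seg S 0 e ∧ (ofLex p).1 < γ} fun p => ⟨fun h => ⟨h.1, h.2⟩, fun ⟨h1, h2⟩ => ⟨h1, h2⟩⟩
  rw [F.toEquiv.cardinal_eq]
  exact mk_le_of_fst le_rfl (mk_Iio_le_aleph_one hγ) fun p hp => hp.2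

theorem mk_omega2 : #(Seg S 0 omega2) = ℵ_ 2 := by
  refine le_antisymm (mk_le_of_fst (aleph_le_aleph.2 one_le_two) mk_Iio_omega2.le fun p hp => hp.2.1) ?_
  rw [← mk_Iio_omega2]
  exact Cardinal.mk_le_of_injective (f := fun i : Iio omega2 =>
    (⟨toLex (i.1, (Classical.arbitrary Theta : WithBot Theta)), bot_le, i.2,
      fun h => (WithBot.coe_ne_bot h).elim⟩ : Seg S 0 omega2)) fun i j h =>
        Subtype.ext (congrArg (fun p : Seg S 0 omega2 => (ofLex p.1).1) h)

end Seg

theorem aleph_one_power_aleph0.{u} (hCH : (2 : Cardinal.{u}) ^ Cardinal.aleph0 = Cardinal.aleph 1) :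
    (ℵ_ 1 : Cardinal.{1}) ^ ℵ₀ = ℵ_ 1 := by
  have h : (2 : Cardinal.{1}) ^ ℵ₀ = ℵ_ 1 := by
    apply Cardinal.lift_injective.{u}
    have := congrArg Cardinal.lift.{1} hCH
    simpa using this
  rw [← h, ← Cardinal.power_mul, aleph0_mul_aleph0]

/-- Under CH, the closure points of a function with countable memory form a closed unbounded
subset of `ω₂`. -/
theorem exists_club_closed_under {X Y ι : Type 1} [Nonempty X] (hCH : (ℵ_ 1 : Cardinal.{1}) ^ ℵ₀ = ℵ_ 1)
    (hι : #ι ≤ ℵ_ 1) (idx : X → Ordinal.{0}) (hidx : ∀ γ < omega2, #{x // idx x < γ} ≤ ℵ_ 1)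
    (idx' : Y → Ordinal.{0}) (hidx' : ∀ y, idx' y < omega2) (r : ι → ι → Prop)
    (hr : ∀ β, #{i // r i β} ≤ ℵ₀) (τ : (ι → X) → ι → Y)
    (hτ : ∀ x x' β, (∀ i, r i β → x i = x' i) → τ x β = τ x' β) :
    ∃ C, ClosedIn C omega2 ∧ UnbddIn C omega2 ∧ ∀ δ ∈ C, ∀ γ < δ, ∀ x β,
      (∀ i, r i β → idx (x i) < γ) → idx' (τ x β) < δ := by
  classical
  have bound : ∀ γ < omega2, ∃ b < omega2, ∀ x β, (∀ i, r i β → idx (x i) < γ) →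
      idx' (τ x β) ≤ b := by
    intro γ hγ
    let V : Set Ordinal.{0} := {v | ∃ x β, (∀ i, r i β → idx (x i) < γ) ∧ idx' (τ x β) = v}
    let ext : (Σ β, {i // r i β} → {x // idx x < γ}) → Ordinal.{0} := fun p =>
      idx' (τ (fun i => if h : r i p.1 then (p.2 ⟨i, h⟩).1 else Classical.arbitrary X) p.1)
    have hV : V ⊆ range ext := by
      rintro _ ⟨x, β, h, rfl⟩
      refine ⟨⟨β, fun i => ⟨x i, h i i.2⟩⟩, congrArg idx' (hτ _ _ _ fun i hi => ?_)⟩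
      simp [hi]
    have hcard : #V ≤ ℵ_ 1 := by
      refine (Cardinal.mk_le_mk_of_subset hV).trans (Cardinal.mk_range_le.trans ?_)
      rw [Cardinal.mk_sigma]
      refine (Cardinal.sum_le_mk_mul_iSup _).trans
        (Cardinal.mul_le_of_le (aleph0_le_aleph 1) hι (ciSup_le' fun β => ?_))
      rw [← Cardinal.power_def, ← hCH]
      exact (Cardinal.power_le_power_right (hidx γ hγ)).trans
        (Cardinal.power_le_power_left (aleph_pos 1).ne' (hr β))
    have hlt : ∀ v ∈ V, v < omega2 := by
      rintro _ ⟨x, β, h, rfl⟩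
      exact hidx' _
    refine ⟨sSup V, sSup_lt_of_lt_cof ?_ hlt, fun x β h =>
      le_csSup ⟨omega2, fun v hv => (hlt v hv).le⟩ ⟨x, β, h, rfl⟩⟩
    rw [← Ordinal.lift_cof, cof_omega2]
    refine hcard.trans_lt ?_
    simp
  choose! c hc hcb using bound
  refine ⟨{δ | ∀ γ < δ, ∀ x β, (∀ i, r i β → idx (x i) < γ) → idx' (τ x β) < δ}, ?_, ?_,
    fun δ hδ γ hγ x β hx => hδ γ hγ x β hx⟩
  · intro α hα _ h γ hγ x β hx
    obtain ⟨γ', hγ', h1, h2⟩ := h γ hγ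
    exact (hγ' γ h1 x β hx).trans h2
  · intro β hβ
    obtain ⟨f, hf, f0, hfe, -, hcf, -⟩ := exists_isNormal_cofinal isSuccLimit_omega2 hβ c hc
    have hlt : ω < omega2.cof.ord := by
      rw [cof_omega2]; exact omega0_lt_omega1.trans omega1_lt_omega2
    refine ⟨f ω, ?_, f0 ▸ hf.strictMono omega0_pos, hfe _ hlt⟩
    intro γ hγ x β hx
    obtain ⟨n, hn, hγn⟩ := (hf.lt_iff_exists_lt isSuccLimit_omega0).1 hγ
    exact (hcb (f n) (hfe _ (hn.trans hlt)) x β fun i hi => (hx i hi).trans hγn).trans_lt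
      ((hcf n).trans (hf.strictMono (isSuccLimit_omega0.add_one_lt hn)))

/-! ### The games -/

theorem mk_Iic_Iio_omega1_le (β : Iio omega1) : #{i : Iio omega1 // i ≤ β} ≤ ℵ₀ := by
  have h : (β.1 + 1).card ≤ ℵ₀ := by
    have := Cardinal.lt_ord.1 (isSuccLimit_omega1.add_one_lt β.2)
    rwa [← Order.lt_succ_iff, succ_aleph0]
  refine (Cardinal.mk_le_of_injective (f := fun i : {i : Iio omega1 // i ≤ β} =>
    (⟨i.1.1, Order.lt_add_one_iff.2 (show i.1.1 ≤ β.1 from i.2)⟩ : Iio (β.1 + 1))) fun i j h =>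
      Subtype.ext (Subtype.ext (Subtype.mk.inj h))).trans ?_
  rw [Cardinal.mk_Iio_ordinal]
  simpa using Cardinal.lift_le.{1}.2 h

theorem mk_Iio_Iio_omega1_le (β : Iio omega1) : #{i : Iio omega1 // i < β} ≤ ℵ₀ :=
  (Cardinal.mk_subtype_mono fun _ => le_of_lt).trans (mk_Iic_Iio_omega1_le β)

namespace Seg

variable {S : Set Ordinal.{0}}

/-- The larger one of the indices of the components of a pair. -/
def pairIdx {P Q : Set (Ordinal.{0} ×ₗ WithBot Theta)} (p : P × Q) : Ordinal.{0} :=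
  max (ofLex p.1.1).1 (ofLex p.2.1).1

/-- The index of a move. -/
def sumIdx {P Q : Set (Ordinal.{0} ×ₗ WithBot Theta)} : P ⊕ Q → Ordinal.{0} :=
  Sum.elim (fun p => (ofLex p.1).1) (fun p => (ofLex p.1).1)

theorem mk_pairIdx_lt_le {T : Set Ordinal.{0}} {d e γ : Ordinal.{0}} (hγ : γ < omega2) :
    #{p : Seg S 0 d × Seg T 0 e // pairIdx p < γ} ≤ ℵ_ 1 := by
  have h : #{p : Seg S 0 d × Seg T 0 e // pairIdx p < γ} ≤
      #({p : Seg S 0 d // (ofLex p.1).1 < γ} × {p : Seg T 0 e // (ofLex p.1).1 < γ}) :=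
    Cardinal.mk_le_of_injective (f := fun p => (⟨p.1.1, (max_lt_iff.1 p.2).1⟩,
      ⟨p.1.2, (max_lt_iff.1 p.2).2⟩)) fun p q h => by
        simp only [Prod.mk.injEq] at h
        exact Subtype.ext (Prod.ext (Subtype.mk.inj h.1) (Subtype.mk.inj h.2))
  refine h.trans ?_
  rw [Cardinal.mk_prod, Cardinal.lift_id, Cardinal.lift_id]
  exact Cardinal.mul_le_of_le (aleph0_le_aleph 1) (mk_fst_lt_le hγ) (mk_fst_lt_le hγ)

theorem mk_sumIdx_lt_le {T : Set Ordinal.{0}} {d e γ : Ordinal.{0}} (hγ : γ < omega2) :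
    #{p : Seg S 0 d ⊕ Seg T 0 e // sumIdx p < γ} ≤ ℵ_ 1 := by
  have h : #{p : Seg S 0 d ⊕ Seg T 0 e // sumIdx p < γ} ≤
      #({p : Seg S 0 d // (ofLex p.1).1 < γ} ⊕ {p : Seg T 0 e // (ofLex p.1).1 < γ}) :=
    (OrderIso.refl _).toEquiv.cardinal_eq.le.trans
      (Equiv.subtypeSum (p := fun p : Seg S 0 d ⊕ Seg T 0 e => sumIdx p < γ)).cardinal_eq.le
  refine h.trans ?_
  rw [Cardinal.mk_sum, Cardinal.lift_id, Cardinal.lift_id]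
  exact Cardinal.add_le_of_le (aleph0_le_aleph 1) (mk_fst_lt_le hγ) (mk_fst_lt_le hγ)

/-- A canonical point with a given index. -/
def point (S : Set Ordinal.{0}) {d e i : Ordinal.{0}} (h : d ≤ i) (h' : i < e) : Seg S d e :=
  ⟨toLex (i, (Classical.arbitrary Theta : WithBot Theta)), h, h',
    fun h => (WithBot.coe_ne_bot h).elim⟩

theorem exists_reply {T : Set Ordinal.{0}} {α e : Ordinal.{0}} (hα0 : 0 < α) (hα : α < e)
    (F : Seg S 0 α ≃o Seg T 0 α) :
    ∃ reply : Seg S 0 e ⊕ Seg T 0 e → Seg S 0 e × Seg T 0 e,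
      (∀ m, MatchesLO m (reply m)) ∧
      ∀ m, sumIdx m < α → ∃ (h1 : (reply m).1.1 ∈ Seg S 0 α) (h2 : (reply m).2.1 ∈ Seg T 0 α),
        F ⟨_, h1⟩ = ⟨_, h2⟩ := by
  classical
  have up : ∀ {S} (p : Seg S 0 α), p.1 ∈ Seg S 0 e := fun p => ⟨p.2.1, p.2.2.1.trans hα, p.2.2.2⟩
  have down : ∀ {S} (p : Seg S 0 e), (ofLex p.1).1 < α → p.1 ∈ Seg S 0 α := fun p h =>
    ⟨p.2.1, h, p.2.2.2⟩
  have key : ∀ m : Seg S 0 e ⊕ Seg T 0 e, ∃ p : Seg S 0 e × Seg T 0 e, MatchesLO m p ∧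
      (sumIdx m < α → ∃ (h1 : p.1.1 ∈ Seg S 0 α) (h2 : p.2.1 ∈ Seg T 0 α),
        F ⟨_, h1⟩ = ⟨_, h2⟩) := by
    rintro (a | b)
    · by_cases h : (ofLex a.1).1 < α
      · exact ⟨(a, ⟨_, up (F ⟨a.1, down a h⟩)⟩), rfl, fun _ => ⟨down a h, (F ⟨a.1, down a h⟩).2, rfl⟩⟩
      · exact ⟨(a, point T le_rfl (hα0.trans hα)), rfl, fun h' => (h h').elim⟩
    · by_cases h : (ofLex b.1).1 < α
      · exact ⟨(⟨_, up (F.symm ⟨b.1, down b h⟩)⟩, b), rfl,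
          fun _ => ⟨(F.symm ⟨b.1, down b h⟩).2, down b h, F.apply_symm_apply _⟩⟩
      · exact ⟨(point S le_rfl (hα0.trans hα), b), rfl, fun h' => (h h').elim⟩
  choose reply h1 h2 using key
  exact ⟨reply, h1, h2⟩

theorem not_forallWin (hCH : (ℵ_ 1 : Cardinal.{1}) ^ ℵ₀ = ℵ_ 1) (hS : S ⊆ S20)
    (hnr : ∀ e ∈ S21, ¬ StationaryIn (S ∩ Iio e) e ∨ ¬ StationaryIn ((S20 \ S) ∩ Iio e) e)
    (hmeet : ∀ C, ClosedIn C omega2 → UnbddIn C omega2 →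
      ∃ α ∈ S21, α ∈ C ∧ ¬ StationaryIn (S ∩ Iio α) α) :
    ¬ EFForallWin omega1 (Seg S 0 omega2) (Seg ∅ 0 omega2) := by
  classical
  rintro ⟨τ, hτ, hwin⟩
  let x₀ : Seg S 0 omega2 × Seg ∅ 0 omega2 :=
    (point S le_rfl isSuccLimit_omega2.bot_lt, point ∅ le_rfl isSuccLimit_omega2.bot_lt)
  have : Nonempty (Seg S 0 omega2 × Seg ∅ 0 omega2) := ⟨x₀⟩
  obtain ⟨C, hC, hC', hcl⟩ := exists_club_closed_under hCH mk_Iio_omega1.le pairIdx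
    (fun γ hγ => mk_pairIdx_lt_le hγ) sumIdx
    (fun y => by
      rcases y with a | b
      exacts [a.2.2.1, b.2.2.1]) (fun i β => i < β) mk_Iio_Iio_omega1_le τ hτ
  obtain ⟨α, hα, hαC, hst⟩ := hmeet C hC hC'
  have hαl := isSuccLimit_of_cof_eq_aleph hα.2 (aleph0_le_aleph 1)
  obtain ⟨F⟩ := orderIso_empty hS hnr hα hst
  obtain ⟨reply, hr1, hr2⟩ := exists_reply hαl.bot_lt hα.1 F
  let y : Iio omega1 → Seg S 0 omega2 × Seg ∅ 0 omega2 :=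
    (wellFounded_lt (α := Iio omega1)).fix fun β ih =>
      reply (τ (fun i => if h : i < β then ih i h else x₀) β)
  have hy : ∀ β, y β = reply (τ y β) := by
    intro β
    refine (WellFounded.fix_eq _ _ _).trans (congrArg reply (hτ _ _ _ fun i hi => ?_))
    exact dif_pos (show i < β from hi)
  have hlt : ∀ β, sumIdx (τ y β) < α := by
    intro β
    induction β using WellFoundedLT.induction with
    | ind β ih =>
      let g : {i // i < β} → Ordinal.{0} := fun i => pairIdx (y i.1) + 1
      have hg : ∀ i, g i < α := fun i => by
        refine hαl.add_one_lt ?_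
        obtain ⟨h1, h2, -⟩ := hr2 _ (ih i.1 i.2)
        rw [hy]
        exact max_lt h1.2.1 h2.2.1
      have hb : ⨆ i, g i < α := by
        refine lift_iSup_lt_of_lt_cof ?_ hg
        rw [← Ordinal.lift_cof, hα.2]
        refine (Cardinal.lift_le.2 (mk_Iio_Iio_omega1_le β)).trans_lt ?_
        simp
      refine hcl α hαC _ hb y β fun i hi => ?_
      have : Small.{0} {i // i < β} := by
        rw [small_iff_lift_mk_lt_univ]
        refine (Cardinal.lift_le.2 (mk_Iio_Iio_omega1_le β)).trans_lt ?_
        simp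
      exact (Order.lt_add_one_iff.2 le_rfl).trans_le (Ordinal.le_iSup g ⟨i, hi⟩)
  have hG : ∀ β, ∃ (h1 : (y β).1.1 ∈ Seg S 0 α) (h2 : (y β).2.1 ∈ Seg ∅ 0 α),
      F ⟨_, h1⟩ = ⟨_, h2⟩ := fun β => by
    rw [hy]
    exact hr2 _ (hlt β)
  refine hwin y (fun β => by rw [hy]; exact hr1 _) ?_
  rintro _ ⟨β, rfl⟩ _ ⟨β', rfl⟩
  obtain ⟨h1, h2, h⟩ := hG β
  obtain ⟨h1', h2', h'⟩ := hG β'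
  constructor
  · change (⟨_, h1⟩ : Seg S 0 α) < ⟨_, h1'⟩ ↔ (⟨_, h2⟩ : Seg ∅ 0 α) < ⟨_, h2'⟩
    rw [← h, ← h', F.lt_iff_lt]
  · have h3 : (⟨_, h1⟩ : Seg S 0 α) = ⟨_, h1'⟩ ↔ (⟨_, h2⟩ : Seg ∅ 0 α) = ⟨_, h2'⟩ := by
      rw [← h, ← h', F.injective.eq_iff]
    rwa [Subtype.mk_eq_mk, Subtype.mk_eq_mk, ← Subtype.ext_iff, ← Subtype.ext_iff] at h3

theorem not_existsWin (hCH : (ℵ_ 1 : Cardinal.{1}) ^ ℵ₀ = ℵ_ 1) (hS : S ⊆ S20)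
    (hst : StationaryIn S omega2) : ¬ EFExistsWin omega1 (Seg S 0 omega2) (Seg ∅ 0 omega2) := by
  classical
  rintro ⟨σ, hσ, hleg, hwin⟩
  have : Nonempty (Seg S 0 omega2 ⊕ Seg ∅ 0 omega2) :=
    ⟨Sum.inl (point S le_rfl isSuccLimit_omega2.bot_lt)⟩
  obtain ⟨C, hC, hC', hcl⟩ := exists_club_closed_under hCH mk_Iio_omega1.le sumIdx
    (fun γ hγ => mk_sumIdx_lt_le hγ) pairIdx
    (fun y : Seg S 0 omega2 × Seg ∅ 0 omega2 => max_lt y.1.2.2.1 y.2.2.2.1)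
    (fun i β => i ≤ β) mk_Iic_Iio_omega1_le σ hσ
  obtain ⟨δ, hδS, hδC, hδ⟩ := hst (C ∩ Iio omega2) inter_subset_right
    (fun α hα h0 h => ⟨hC α hα h0 fun β hβ => let ⟨γ, hγ, h⟩ := h β hβ; ⟨γ, hγ.1, h⟩, hα⟩)
    (fun β hβ => let ⟨γ, hγ, h⟩ := hC' β hβ; ⟨γ, ⟨hγ, h.2⟩, h⟩)
  replace hδ : δ < omega2 := hδ
  have hδl := isSuccLimit_of_cof_eq_aleph (hS hδS).2 le_rfl
  obtain ⟨f, hf, -, hfe, -, -, hcf⟩ := exists_isNormal_cofinal hδl hδl.bot_lt id fun _ h => h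
  rw [show δ.cof.ord = ω by rw [(hS hδS).2, ord_aleph0]] at hfe hcf
  have hdp : toLex (δ, (⊥ : WithBot Theta)) ∈ Seg S 0 omega2 := ⟨bot_le, hδ, fun _ => hδS⟩
  let m : Iio (ω : Ordinal.{0}) → Seg S 0 omega2 ⊕ Seg ∅ 0 omega2 := fun i =>
    if Even (Cardinal.toNat i.1.card) then Sum.inl (point S bot_le ((hfe i.1 i.2).trans hδ))
    else Sum.inr (point ∅ bot_le ((hfe i.1 i.2).trans hδ))
  have hm : ∀ i, sumIdx (m i) = f i := fun i => by
    simp only [m]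
    split_ifs <;> rfl
  let x : Seg ∅ 0 omega2 → Iio omega1 → Seg S 0 omega2 ⊕ Seg ∅ 0 omega2 := fun z i =>
    if h : i.1 < ω then m ⟨i.1, h⟩ else if i.1 = ω then Sum.inl ⟨_, hdp⟩ else Sum.inr z
  have hw1 : ω + 1 < omega1 := isSuccLimit_omega1.add_one_lt omega0_lt_omega1
  let w : Iio omega1 := ⟨ω, omega0_lt_omega1⟩
  let w' : Iio omega1 := ⟨ω + 1, hw1⟩
  have hww : ω < (ω + 1 : Ordinal.{0}) := Order.lt_add_one_iff.2 le_rfl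
  have hsmall : ∀ z (i : Iio omega1), i.1 < ω → pairIdx (σ (x z) i) < δ := by
    intro z i hi
    have hi1 := isSuccLimit_omega0.add_one_lt hi
    refine hcl δ hδC (f (i.1 + 1)) (hfe _ hi1) (x z) i fun j hj => ?_
    have hj' : j.1 < ω := lt_of_le_of_lt (show j.1 ≤ i.1 from hj) hi
    simp only [x, dif_pos hj', hm]
    exact hf.strictMono (Order.lt_add_one_iff.2 hj)
  have even : ∀ z, ∀ ρ < δ, ∃ i : Iio omega1, i.1 < ω ∧ ρ < (ofLex (σ (x z) i).1.1).1 := by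
    intro z ρ hρ
    obtain ⟨i, hi, hlt⟩ := hcf ρ hρ
    obtain ⟨n, rfl⟩ := lt_omega0.1 hi
    have h2n : ((2 * n : ℕ) : Ordinal.{0}) < ω := natCast_lt_omega0 _
    let j : Iio omega1 := ⟨_, h2n.trans omega0_lt_omega1⟩
    refine ⟨j, h2n, hlt.trans_le ?_⟩
    have h := hleg (x z) j
    have hx : x z j = Sum.inl (point S bot_le ((hfe j.1 h2n).trans hδ)) := by
      have h' : Even (Cardinal.toNat j.1.card) := by
        simp only [j, card_nat, toNat_natCast]
        simp
      simp only [x, dif_pos (show j.1 < ω from h2n), m, if_pos h']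
    rw [hx] at h
    replace h : (σ (x z) j).1 = point S bot_le ((hfe j.1 h2n).trans hδ) := h
    rw [h]
    refine hf.strictMono.monotone ?_
    simp only [j]
    exact_mod_cast (by omega : n ≤ 2 * n)
  have odd : ∀ z, ∀ ρ < δ, ∃ i : Iio omega1, i.1 < ω ∧ ρ < (ofLex (σ (x z) i).2.1).1 := by
    intro z ρ hρ
    obtain ⟨i, hi, hlt⟩ := hcf ρ hρ
    obtain ⟨n, rfl⟩ := lt_omega0.1 hi
    have h2n : ((2 * n + 1 : ℕ) : Ordinal.{0}) < ω := natCast_lt_omega0 _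
    let j : Iio omega1 := ⟨_, h2n.trans omega0_lt_omega1⟩
    refine ⟨j, h2n, hlt.trans_le ?_⟩
    have h := hleg (x z) j
    have hx : x z j = Sum.inr (point ∅ bot_le ((hfe j.1 h2n).trans hδ)) := by
      have h' : ¬ Even (Cardinal.toNat j.1.card) := by
        simp only [j, card_nat, toNat_natCast]
        simp
      simp only [x, dif_pos (show j.1 < ω from h2n), m, if_neg h']
    rw [hx] at h
    replace h : (σ (x z) j).2 = point ∅ bot_le ((hfe j.1 h2n).trans hδ) := h
    rw [h]
    refine hf.strictMono.monotone ?_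
    simp only [j]
    exact_mod_cast (by omega : n ≤ 2 * n + 1)
  have hiso : ∀ z i j, (σ (x z) i).1 < (σ (x z) j).1 ↔ (σ (x z) i).2 < (σ (x z) j).2 :=
    fun z i j => (hwin (x z) _ ⟨i, rfl⟩ _ ⟨j, rfl⟩).1
  have hw : ∀ z, (σ (x z) w).1 = ⟨_, hdp⟩ := fun z => by
    have h := hleg (x z) w
    have hx : x z w = Sum.inl ⟨_, hdp⟩ := by simp [x, w]
    rwa [hx] at h
  have hw' : ∀ z, (σ (x z) w').2 = z := fun z => by
    have h := hleg (x z) w'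
    have hx : x z w' = Sum.inr z := by simp [x, w', hww.not_gt, hww.ne']
    rwa [hx] at h
  have hcaus : ∀ z z', σ (x z) w = σ (x z') w := fun z z' => hσ _ _ _ fun i hi => by
    rcases lt_or_eq_of_le (show i.1 ≤ ω from hi) with h | h
    · simp only [x, dif_pos h]
    · simp [x, h]
  have of_lt : ∀ p : Seg S 0 omega2, p < ⟨_, hdp⟩ ↔ (ofLex p.1).1 < δ := fun p => by
    refine (Prod.Lex.lt_iff (x := p.1)).trans ⟨fun h => h.resolve_right fun h => ?_, Or.inl⟩
    exact not_lt_bot h.2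
  let y : Seg ∅ 0 omega2 := (σ (x (point ∅ le_rfl isSuccLimit_omega2.bot_lt)) w).2
  have hy : ∀ z, (σ (x z) w).2 = y := fun z => congrArg Prod.snd (hcaus _ _)
  have hyδ : δ ≤ (ofLex y.1).1 := by
    by_contra! h
    obtain ⟨i, hi, hlt⟩ := odd y _ h
    have h1 : (σ (x y) i).1 < (σ (x y) w).1 := by
      rw [hw, of_lt]
      exact (le_max_left _ _).trans_lt (hsmall y i hi)
    rw [hiso, hy] at h1
    exact hlt.not_ge (monotone_fst h1.le)
  obtain ⟨z, hzy, hz⟩ : ∃ z < y, δ ≤ (ofLex z.1).1 := by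
    obtain ⟨⟨i, v⟩, h1, h2, h3⟩ := y
    induction v using WithBot.recBotCoe with
    | bot => exact (h3 rfl).elim
    | coe v =>
      obtain ⟨v', hv⟩ := exists_lt v
      exact ⟨⟨toLex (i, (v' : WithBot Theta)), h1, h2, fun h => (WithBot.coe_ne_bot h).elim⟩,
        Prod.Lex.lt_iff.2 (Or.inr ⟨rfl, WithBot.coe_lt_coe.2 hv⟩), hyδ⟩
  have h1 : (σ (x z) w').1 < (σ (x z) w).1 := by
    rw [hiso, hy, hw']
    exact hzy
  rw [hw, of_lt] at h1
  obtain ⟨i, hi, hlt⟩ := even z _ h1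
  have h2 : (σ (x z) w').1 < (σ (x z) i).1 := Prod.Lex.lt_iff.2 (Or.inl hlt)
  rw [hiso, hw'] at h2
  exact (hz.trans (monotone_fst h2.le)).not_gt ((le_max_right _ _).trans_lt (hsmall z i hi))

theorem conclusion (hCH : (ℵ_ 1 : Cardinal.{1}) ^ ℵ₀ = ℵ_ 1) (hS : S ⊆ S20)
    (hst : StationaryIn S omega2)
    (hnr : ∀ e ∈ S21, ¬ StationaryIn (S ∩ Iio e) e ∨ ¬ StationaryIn ((S20 \ S) ∩ Iio e) e)
    (hmeet : ∀ C, ClosedIn C omega2 → UnbddIn C omega2 →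
      ∃ α ∈ S21, α ∈ C ∧ ¬ StationaryIn (S ∩ Iio α) α) :
    ∃ (A : Type 1) (_ : LinearOrder A) (B : Type 1) (_ : LinearOrder B),
      Cardinal.mk A = Cardinal.aleph 2 ∧ Cardinal.mk B = Cardinal.aleph 2 ∧
      ¬ EFExistsWin omega1 A B ∧ ¬ EFForallWin omega1 A B :=
  ⟨Seg S 0 omega2, inferInstance, Seg ∅ 0 omega2, inferInstance, mk_omega2, mk_omega2,
    not_existsWin hCH hS hst, not_forallWin hCH hS hnr hmeet⟩

end Seg

theorem stmt8 (hCH : (2 : Cardinal) ^ Cardinal.aleph0 = Cardinal.aleph 1)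
    (hex : ∃ S : Set Ordinal.{0}, S ⊆ S20 ∧
      StationaryIn S omega2 ∧ StationaryIn (S20 \ S) omega2 ∧
      ¬ ∃ α ∈ S21, StationaryIn (S ∩ Set.Iio α) α ∧
        StationaryIn ((S20 \ S) ∩ Set.Iio α) α) :
    ∃ (A : Type 1) (_ : LinearOrder A) (B : Type 1) (_ : LinearOrder B),
      Cardinal.mk A = Cardinal.aleph 2 ∧ Cardinal.mk B = Cardinal.aleph 2 ∧
      ¬ EFExistsWin omega1 A B ∧ ¬ EFForallWin omega1 A B := by
  obtain ⟨S, hS, hst, hst', hno⟩ := hex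
  have hCH' := aleph_one_power_aleph0 hCH
  have hnr : ∀ e ∈ S21, ¬ StationaryIn (S ∩ Iio e) e ∨ ¬ StationaryIn ((S20 \ S) ∩ Iio e) e := by
    intro e he
    by_contra! h
    exact hno ⟨e, he, h⟩
  by_cases hmeet : ∀ C, ClosedIn C omega2 → UnbddIn C omega2 →
      ∃ α ∈ S21, α ∈ C ∧ ¬ StationaryIn (S ∩ Iio α) α
  · exact Seg.conclusion hCH' hS hst hnr hmeet
  · push Not at hmeet
    obtain ⟨C, hC, hC', h⟩ := hmeet
    have hSS : S20 \ (S20 \ S) = S := sdiff_sdiff_cancel_left hS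
    refine Seg.conclusion hCH' (S := S20 \ S) sdiff_subset hst' (fun e he => ?_) fun D hD hD' => ?_
    · rw [hSS]
      exact (hnr e he).symm
    · obtain ⟨α, hα, hαC, hαD⟩ := exists_mem_S21_of_club hC hC' hD hD'
      exact ⟨α, hα, hαD, (hnr α hα).resolve_left (not_not.2 (h α hα hαC))⟩
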